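/- Let M be a MAG and P its PAG (so M ∈ [P]), and let X, Y, Z be pairwise disjoint node sets with X and Y nonempty. Suppose P is adjustment amenable relative to (X,Y) and Z ∩ Forb(X,Y,P) = ∅. Let p be a shortest proper non-causal path from X to Y that is m-connecting given Z in M, and let p* denote the path in P constituted by the same sequence of nodes. Then p* is a proper definite status non-causal path in P. -/

import Mathlib

open scoped Classical

/-- Edge marks: tail, arrowhead, circle. -/
inductive Mark : Type
  | tail
  | arrow
  | circle
  deriving DecidableEq

/-- A partial mixed graph over a node set `V`: any two distinct nodes are joined by
at most one edge; `mark a b` is the mark at `b` on the edge between `a` and `b`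
(`none` if there is no edge). -/
structure PMG (V : Type) where
  mark : V → V → Option Mark
  symm : ∀ a b, (mark a b).isSome ↔ (mark b a).isSome
  irrefl : ∀ a, mark a a = none

namespace PMG

variable {V : Type}

/-- `a` and `b` are adjacent. -/
def Adj (G : PMG V) (a b : V) : Prop := (G.mark a b).isSome

/-- directed edge `a → b`. -/
def DirEdge (G : PMG V) (a b : V) : Prop :=
  G.mark a b = some Mark.arrow ∧ G.mark b a = some Mark.tail

/-- bidirected edge `a ↔ b`. -/
def BidirEdge (G : PMG V) (a b : V) : Prop :=
  G.mark a b = some Mark.arrow ∧ G.mark b a = some Mark.arrow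

/-- non-directed edge `a o-o b`. -/
def NondirEdge (G : PMG V) (a b : V) : Prop :=
  G.mark a b = some Mark.circle ∧ G.mark b a = some Mark.circle

/-- A path: a nonempty list of distinct nodes in which successive nodes are adjacent. -/
def IsPath (G : PMG V) (p : List V) : Prop :=
  p ≠ [] ∧ p.Nodup ∧ p.Chain' G.Adj

/-- A path from `a` to `b` (with at least one edge). -/
def IsPathFromTo (G : PMG V) (p : List V) (a b : V) : Prop :=
  IsPath G p ∧ p.head? = some a ∧ p.getLast? = some b ∧ 2 ≤ p.length

/-- All edges on `p` are directed towards the end of `p`. -/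
def DirectedAlong (G : PMG V) (p : List V) : Prop :=
  ∀ i a b, p[i]? = some a → p[i+1]? = some b → G.DirEdge a b

/-- No edge on `p` has an arrowhead at its endpoint closer to the start of `p`
(`p` is possibly directed). -/
def PossDirAlong (G : PMG V) (p : List V) : Prop :=
  ∀ i a b, p[i]? = some a → p[i+1]? = some b → G.mark b a ≠ some Mark.arrow

/-- `b` is a descendant of `a`: a directed path (possibly of length 0) from `a` to `b`. -/
def Descendant (G : PMG V) (a b : V) : Prop :=
  ∃ p, IsPath G p ∧ DirectedAlong G p ∧ p.head? = some a ∧ p.getLast? = some b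

/-- `b` is a possible descendant of `a`. -/
def PossDescendant (G : PMG V) (a b : V) : Prop :=
  ∃ p, IsPath G p ∧ PossDirAlong G p ∧ p.head? = some a ∧ p.getLast? = some b

/-- The node at position `i+1` of `p` is a collider on `p`. -/
def ColliderAt (G : PMG V) (p : List V) (i : ℕ) : Prop :=
  ∃ a b c, p[i]? = some a ∧ p[i+1]? = some b ∧ p[i+2]? = some c ∧
    G.mark a b = some Mark.arrow ∧ G.mark c b = some Mark.arrow

/-- The node at position `i+1` of `p` is a definite non-collider on `p`. -/
def DefNonColliderAt (G : PMG V) (p : List V) (i : ℕ) : Prop :=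
  ∃ a b c, p[i]? = some a ∧ p[i+1]? = some b ∧ p[i+2]? = some c ∧
    (G.mark a b = some Mark.tail ∨ G.mark c b = some Mark.tail ∨
      (G.mark a b = some Mark.circle ∧ G.mark c b = some Mark.circle ∧ ¬ G.Adj a c))

/-- `p` is of definite status. -/
def DefStatus (G : PMG V) (p : List V) : Prop :=
  ∀ i, i + 2 < p.length → (ColliderAt G p i ∨ DefNonColliderAt G p i)

/-- `p` is a definite status path that is m-connecting given `Z`. -/
def MConn (G : PMG V) (Z : Finset V) (p : List V) : Prop :=
  DefStatus G p ∧
  (∀ i b, p[i+1]? = some b → DefNonColliderAt G p i → b ∉ Z) ∧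
  (∀ i b, p[i+1]? = some b → ColliderAt G p i → ∃ z ∈ Z, Descendant G b z)

/-- `a` and `b` are m-separated given `Z`: every definite status path between them
is blocked by `Z`. -/
def MSep (G : PMG V) (a b : V) (Z : Finset V) : Prop :=
  ∀ p, IsPathFromTo G p a b → ¬ MConn G Z p

/-- Two graphs have the same m-separation relations. -/
def MarkovEquiv (G H : PMG V) : Prop :=
  ∀ a b (Z : Finset V), a ≠ b → a ∉ Z → b ∉ Z → (MSep G a b Z ↔ MSep H a b Z)

/-- `G` is a DAG: all edges directed and no directed cycle. -/
def IsDAG (G : PMG V) : Prop :=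
  (∀ a b, G.Adj a b → G.DirEdge a b ∨ G.DirEdge b a) ∧
  (∀ a b, Descendant G a b → Descendant G b a → a = b)

/-- A mixed graph: edges only `→` or `↔`. -/
def IsMixed (G : PMG V) : Prop :=
  ∀ a b, G.Adj a b → G.DirEdge a b ∨ G.DirEdge b a ∨ G.BidirEdge a b

/-- Ancestral mixed graph: no directed cycle, no almost directed cycle. -/
def IsAncestral (G : PMG V) : Prop :=
  IsMixed G ∧ (∀ a b, Descendant G a b → Descendant G b a → a = b) ∧
  (∀ a b, Descendant G a b → ¬ G.BidirEdge b a)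

/-- Maximal ancestral graph. -/
def IsMAG (G : PMG V) : Prop :=
  IsAncestral G ∧ ∀ a b : V, a ≠ b → ¬ G.Adj a b →
    ∃ Z : Finset V, a ∉ Z ∧ b ∉ Z ∧ MSep G a b Z

/-- A collider path from `v` to `x` that is into `x` and all of whose
non-endpoint nodes are parents of `y`. -/
def ColliderPathInto (G : PMG V) (v x y : V) : Prop :=
  ∃ p : List V, IsPathFromTo G p v x ∧
    (∀ i, i + 2 < p.length → ColliderAt G p i) ∧
    (∃ a, p[p.length - 2]? = some a ∧ G.mark a x = some Mark.arrow) ∧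
    (∀ c ∈ p, c ≠ v → c ≠ x → G.DirEdge c y)

/-- The directed edge `x → y` is visible (in a MAG or PAG). -/
def Visible (G : PMG V) (x y : V) : Prop :=
  G.DirEdge x y ∧
  ∃ v, v ≠ y ∧ ¬ G.Adj v y ∧
    (G.mark v x = some Mark.arrow ∨ ColliderPathInto G v x y)

/-- `p` is a proper path from the node set `X` to the node set `Y`. -/
def ProperPath (G : PMG V) (X Y : Finset V) (p : List V) : Prop :=
  IsPath G p ∧ (∃ a ∈ X, p.head? = some a) ∧ (∃ b ∈ Y, p.getLast? = some b) ∧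
  (∀ c ∈ p.tail, c ∉ X)

/-- `p` starts with an edge satisfying `vis` out of its first node. -/
def StartsVisible (vis : V → V → Prop) (p : List V) : Prop :=
  ∃ a b, p[0]? = some a ∧ p[1]? = some b ∧ vis a b

/-- Adjustment amenability relative to `(X,Y)`, with visibility predicate `vis`. -/
def Amenable (G : PMG V) (vis : V → V → Prop) (X Y : Finset V) : Prop :=
  ∀ p, ProperPath G X Y p → PossDirAlong G p → StartsVisible vis p

/-- Forbidden nodes: possible descendants of a node `w ∉ X` lying on a proper
possibly causal path from `X` to `Y`. -/
def Forb (G : PMG V) (X Y : Finset V) : Set V :=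
  { v | ∃ w, w ∉ X ∧
      (∃ p, ProperPath G X Y p ∧ PossDirAlong G p ∧ w ∈ p) ∧
      PossDescendant G w v }

/-- Forbidden nodes in a DAG or MAG: descendants of a node `w ∉ X` lying on a
proper causal path from `X` to `Y`. -/
def ForbD (G : PMG V) (X Y : Finset V) : Set V :=
  { v | ∃ w, w ∉ X ∧
      (∃ p, ProperPath G X Y p ∧ DirectedAlong G p ∧ w ∈ p) ∧
      Descendant G w v }

/-- The generalized adjustment criterion (GAC) relative to `(X,Y)`, with
visibility predicate `vis`. -/
def GAC (G : PMG V) (vis : V → V → Prop) (X Y Z : Finset V) : Prop :=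
  Amenable G vis X Y ∧
  (∀ z ∈ Z, z ∉ Forb G X Y) ∧
  (∀ p, ProperPath G X Y p → DefStatus G p → ¬ PossDirAlong G p → ¬ MConn G Z p)

/-- The adjustment criterion (AC) for DAGs and MAGs relative to `(X,Y)`, with
visibility predicate `vis`. -/
def AC (H : PMG V) (vis : V → V → Prop) (X Y Z : Finset V) : Prop :=
  (∀ p, ProperPath H X Y p → DirectedAlong H p → StartsVisible vis p) ∧
  (∀ z ∈ Z, z ∉ ForbD H X Y) ∧
  (∀ p, ProperPath H X Y p → ¬ PossDirAlong H p → ¬ MConn H Z p)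

/-- `cls` is the Markov equivalence class of DAGs represented by the CPDAG `G`. -/
def IsCPDAGOf (G : PMG V) (cls : Set (PMG V)) : Prop :=
  cls.Nonempty ∧
  (∀ D ∈ cls, IsDAG D) ∧
  (∀ D ∈ cls, ∀ D', IsDAG D' → MarkovEquiv D D' → D' ∈ cls) ∧
  (∀ D ∈ cls, ∀ D' ∈ cls, MarkovEquiv D D') ∧
  (∀ D ∈ cls, ∀ a b, G.Adj a b ↔ D.Adj a b) ∧
  (∀ a b, G.Adj a b → (G.DirEdge a b ∨ G.NondirEdge a b)) ∧
  (∀ a b, G.DirEdge a b ↔ (G.Adj a b ∧ ∀ D ∈ cls, D.DirEdge a b))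

/-- `cls` is the Markov equivalence class of MAGs represented by the PAG `P`. -/
def IsPAGOf (P : PMG V) (cls : Set (PMG V)) : Prop :=
  cls.Nonempty ∧
  (∀ M ∈ cls, IsMAG M) ∧
  (∀ M ∈ cls, ∀ M', IsMAG M' → MarkovEquiv M M' → M' ∈ cls) ∧
  (∀ M ∈ cls, ∀ M' ∈ cls, MarkovEquiv M M') ∧
  (∀ M ∈ cls, ∀ a b, P.Adj a b ↔ M.Adj a b) ∧
  (∀ a b, P.mark a b = some Mark.arrow ↔ (P.Adj a b ∧ ∀ M ∈ cls, M.mark a b = some Mark.arrow)) ∧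
  (∀ a b, P.mark a b = some Mark.tail ↔ (P.Adj a b ∧ ∀ M ∈ cls, M.mark a b = some Mark.tail))

section Density

variable {Ω : Type} [Fintype V] [DecidableEq V] [Fintype Ω]

/-- `f` is a probability density (pmf) over the joint state space. -/
def IsDensity (f : (V → Ω) → ℝ) : Prop :=
  (∀ v, 0 ≤ f v) ∧ ∑ v, f v = 1

/-- The marginal density of the variables in `S`, evaluated at `v`. -/
noncomputable def margOn (f : (V → Ω) → ℝ) (S : Finset V) (v : V → Ω) : ℝ :=
  ∑ w : V → Ω, if ∀ i ∈ S, w i = v i then f w else 0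

/-- The conditional density of the variables in `A` given those in `B`, at `v`. -/
noncomputable def condOn (f : (V → Ω) → ℝ) (A B : Finset V) (v : V → Ω) : ℝ :=
  margOn f (A ∪ B) v / margOn f B v

/-- The parents of `i` in `G`. -/
noncomputable def parents (G : PMG V) (i : V) : Finset V :=
  Finset.univ.filter (fun j => G.DirEdge j i)

/-- `f` factorizes according to the DAG `G`. -/
def ConsistentWith (G : PMG V) (f : (V → Ω) → ℝ) : Prop :=
  ∀ v, f v = ∏ i, condOn f {i} (parents G i) v

/-- The post-intervention density `f(· | do(X = xval))` (truncated factorization). -/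
noncomputable def doDens (G : PMG V) (f : (V → Ω) → ℝ) (X : Finset V) (xval : V → Ω) :
    (V → Ω) → ℝ :=
  fun v => if ∀ i ∈ X, v i = xval i then ∏ i ∈ Xᶜ, condOn f {i} (parents G i) v else 0

/-- Overwrite `v` on `Z` by the assignment `w`. -/
noncomputable def patch (Z : Finset V) (v : V → Ω) (w : {i // i ∈ Z} → Ω) : V → Ω :=
  fun i => if h : i ∈ Z then w ⟨i, h⟩ else v i

end Density

/-- `Z` is an adjustment set relative to `(X,Y)` in the DAG `D`: for every finite state
space and every density consistent with `D`, the adjustment formula holds. -/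
def IsAdjSetDAG [Fintype V] [DecidableEq V] (D : PMG V) (X Y Z : Finset V) : Prop :=
  ∀ (Ω : Type) [Fintype Ω] [DecidableEq Ω] (f : (V → Ω) → ℝ),
    IsDensity f → ConsistentWith D f →
    ∀ v : V → Ω,
      margOn (doDens D f X v) Y v =
        if Z = ∅ then condOn f Y X v
        else ∑ w : ({i // i ∈ Z} → Ω),
          condOn f Y (X ∪ Z) (patch Z v w) * margOn f Z (patch Z v w)

/-- The marginal of a density over `V ⊕ L` on the observed variables `V`. -/
noncomputable def obsMargin {L : Type} [Fintype V] [Fintype L] [DecidableEq V] [DecidableEq L]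
    {Ω : Type} [Fintype Ω] (f : ((V ⊕ L) → Ω) → ℝ) : (V → Ω) → ℝ :=
  fun v => ∑ w : (V ⊕ L) → Ω, if ∀ i : V, w (Sum.inl i) = v i then f w else 0

/-- `M` is the MAG over the observed variables `V` of the DAG `D'` over `V ⊕ L`. -/
def IsMAGOverObs {L : Type} (D' : PMG (V ⊕ L)) (M : PMG V) : Prop :=
  (∀ a b : V, M.Adj a b ↔ (a ≠ b ∧ ∀ S : Finset V, a ∉ S → b ∉ S →
      ¬ MSep D' (Sum.inl a) (Sum.inl b) (S.image Sum.inl))) ∧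
  (∀ a b : V, M.Adj a b →
    ((M.mark a b = some Mark.arrow ↔ ¬ Descendant D' (Sum.inl b) (Sum.inl a)) ∧
     (M.mark a b = some Mark.tail ↔ Descendant D' (Sum.inl b) (Sum.inl a))))

/-- `Z` is an adjustment set relative to `(X,Y)` in the MAG `M`: for every DAG `D'`
with latent variables whose MAG over `V` is `M` and every consistent density,
the adjustment formula holds for the observed margin. -/
def IsAdjSetMAG [Fintype V] [DecidableEq V] (M : PMG V) (X Y Z : Finset V) : Prop :=
  ∀ (Ω L : Type) [Fintype Ω] [DecidableEq Ω] [Fintype L] [DecidableEq L]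
    (D' : PMG (V ⊕ L)) (f' : ((V ⊕ L) → Ω) → ℝ),
    IsDAG D' → IsMAGOverObs D' M → IsDensity f' → ConsistentWith D' f' →
    ∀ v : (V ⊕ L) → Ω,
      margOn (obsMargin (doDens D' f' (X.image Sum.inl) v)) Y (fun i => v (Sum.inl i)) =
        if Z = ∅ then condOn (obsMargin f') Y X (fun i => v (Sum.inl i))
        else ∑ w : ({i // i ∈ Z} → Ω),
          condOn (obsMargin f') Y (X ∪ Z) (patch Z (fun i => v (Sum.inl i)) w) *
            margOn (obsMargin f') Z (patch Z (fun i => v (Sum.inl i)) w)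

/-- The distance-from-`Z` of a node `q`: the length of a shortest directed path
(possibly of length 0) from `q` to a member of `Z`. -/
noncomputable def distZ (G : PMG V) (Z : Finset V) (q : V) : ℕ :=
  sInf { n | ∃ p, IsPath G p ∧ DirectedAlong G p ∧ p.head? = some q ∧
      (∃ z ∈ Z, p.getLast? = some z) ∧ p.length = n + 1 }

/-- The distance-from-`Z` of a path `p`: the sum of the distances-from-`Z`
of the colliders on `p`. -/
noncomputable def pathDistZ (G : PMG V) (Z : Finset V) (p : List V) : ℕ :=
  ∑ i ∈ Finset.range p.length,
    if ColliderAt G p i then (p[i+1]?.elim 0 (distZ G Z)) else 0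

end PMG

namespace PMG

variable {V : Type}

/-- There is an arrowhead at `b` on the edge between `a` and `b`. -/
abbrev Arr (G : PMG V) (a b : V) : Prop := G.mark a b = some Mark.arrow

/-- There is a tail at `b` on the edge between `a` and `b`. -/
abbrev Tl (G : PMG V) (a b : V) : Prop := G.mark a b = some Mark.tail

/-- `b` is an ancestor of `Z`. -/
def AnZ (G : PMG V) (Z : Finset V) (b : V) : Prop := ∃ z ∈ Z, Descendant G b z

/-- The triple `a, b, c` is open given `Z`. -/
def TOpen (G : PMG V) (Z : Finset V) (a b c : V) : Prop :=
  (G.Arr a b ∧ G.Arr c b ∧ AnZ G Z b) ∨ ((G.Tl a b ∨ G.Tl c b) ∧ b ∉ Z)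

theorem Adj.symm' {G : PMG V} {a b : V} (h : G.Adj a b) : G.Adj b a := (G.symm a b).1 h

theorem Arr.adj {G : PMG V} {a b : V} (h : G.Arr a b) : G.Adj a b := by
  simp [Adj, h]

theorem Tl.adj {G : PMG V} {a b : V} (h : G.Tl a b) : G.Adj a b := by
  simp [Adj, h]

theorem Adj.ne {G : PMG V} {a b : V} (h : G.Adj a b) : a ≠ b := by
  rintro rfl
  simp [Adj, G.irrefl] at h

theorem Arr.not_tl {G : PMG V} {a b : V} (h : G.Arr a b) : ¬ G.Tl a b := by
  intro h'
  simp [Arr, Tl] at h h'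
  simp [h] at h'

theorem IsMixed.arr_or {G : PMG V} (hG : IsMixed G) {a b : V} (h : G.Adj a b) :
    G.Arr a b ∨ G.DirEdge b a := by
  rcases hG a b h with h | h | h
  · exact Or.inl h.1
  · exact Or.inr h
  · exact Or.inl h.1

theorem IsMixed.dir_of_tl {G : PMG V} (hG : IsMixed G) {a b : V} (h : G.Tl a b) :
    G.DirEdge b a := by
  rcases hG.arr_or h.adj with h' | h'
  · exact absurd h h'.not_tl
  · exact h'

theorem IsMixed.arr_of_not_dir {G : PMG V} (hG : IsMixed G) {a b : V} (h : G.Adj a b)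
    (h' : ¬ G.DirEdge b a) : G.Arr a b := (hG.arr_or h).resolve_right h'

theorem IsMixed.dir_of_not_arr {G : PMG V} (hG : IsMixed G) {a b : V} (h : G.Adj a b)
    (h' : ¬ G.Arr a b) : G.DirEdge b a := (hG.arr_or h).resolve_left h'

theorem DirEdge.adj {G : PMG V} {a b : V} (h : G.DirEdge a b) : G.Adj a b := by
  simp [Adj, h.1]

theorem DirEdge.not_arr {G : PMG V} {a b : V} (h : G.DirEdge a b) : ¬ G.Arr b a :=
  fun h' => h'.not_tl h.2

theorem Descendant.refl (G : PMG V) (a : V) : Descendant G a a := by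
  refine ⟨[a], ⟨by simp, by simp, List.isChain_singleton a⟩, ?_, by simp, by simp⟩
  intro i x y hx hy
  simp at hy

theorem isPath_cons {G : PMG V} {a b : V} {t : List V} (h : IsPath G (b :: t))
    (hab : G.Adj a b) (hn : a ∉ b :: t) : IsPath G (a :: b :: t) := by
  obtain ⟨_, h2, h3⟩ := h
  refine ⟨by simp, List.nodup_cons.2 ⟨hn, h2⟩, ?_⟩
  exact List.isChain_cons_cons.2 ⟨hab, h3⟩

theorem Descendant.cons {G : PMG V} {a b z : V} (hab : G.DirEdge a b)
    (h : Descendant G b z) : Descendant G a z := by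
  obtain ⟨p, hp, hd, hh, hl⟩ := h
  by_cases ha : a ∈ p
  · obtain ⟨s, t, rfl⟩ := List.append_of_mem ha
    refine ⟨a :: t, ⟨by simp, ?_, ?_⟩, ?_, by simp, ?_⟩
    · exact (List.nodup_append.1 hp.2.1).2.1
    · exact (List.isChain_append.1 hp.2.2).2.1
    · intro i x y hx hy
      apply hd (s.length + i) x y
      · rw [List.getElem?_append_right (by omega)]; simpa using hx
      · rw [List.getElem?_append_right (by omega)]
        have : s.length + i + 1 - s.length = i + 1 := by omega
        rw [this]; exact hy
    · rw [List.getLast?_append] at hl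
      simpa using hl
  · obtain ⟨c, t, rfl⟩ : ∃ c t, p = c :: t := by
      cases p with
      | nil => exact absurd rfl hp.1
      | cons c t => exact ⟨c, t, rfl⟩
    simp at hh
    subst hh
    refine ⟨a :: c :: t, isPath_cons hp hab.adj ha, ?_, by simp, ?_⟩
    · intro i x y hx hy
      cases i with
      | zero => simp at hx hy; subst hx; subst hy; exact hab
      | succ i => exact hd i x y (by simpa using hx) (by simpa using hy)
    · rw [List.getLast?_cons_cons]; exact hl

theorem AnZ.cons {G : PMG V} {Z : Finset V} {a b : V} (hab : G.DirEdge a b)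
    (h : AnZ G Z b) : AnZ G Z a := by
  obtain ⟨z, hz, h⟩ := h
  exact ⟨z, hz, h.cons hab⟩

theorem AnZ.of_mem {G : PMG V} {Z : Finset V} {a : V} (h : a ∈ Z) : AnZ G Z a :=
  ⟨a, h, Descendant.refl G a⟩

/-- In an ancestral graph, `a *→ b → c` with `a, c` adjacent gives `a *→ c`. -/
theorem IsAncestral.arr_trans {G : PMG V} (hG : IsAncestral G) {a b c : V}
    (hab : G.Arr a b) (hbc : G.DirEdge b c) (hac : G.Adj a c) : G.Arr a c := by
  apply hG.1.arr_of_not_dir hac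
  intro hca
  have hba : Descendant G b a := ((Descendant.refl G a).cons hca).cons hbc
  rcases hG.1.arr_or hab.adj.symm' with h | h
  · exact hG.2.2 b a hba ⟨hab, h⟩
  · exact hab.adj.ne (hG.2.1 a b ((Descendant.refl G b).cons h) hba)

/-- In an ancestral graph, `a → b → c` with `a, c` adjacent gives `a → c`. -/
theorem IsAncestral.dir_trans {G : PMG V} (hG : IsAncestral G) {a b c : V}
    (hab : G.DirEdge a b) (hbc : G.DirEdge b c) (hac : G.Adj a c) : G.DirEdge a c := by
  apply hG.1.dir_of_not_arr hac.symm'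
  intro h
  exact hbc.not_arr (hG.arr_trans h hab hbc.adj.symm')

/-- In an ancestral graph, `a → b *→ c` with `a, c` adjacent gives `a *→ c`. -/
theorem IsAncestral.arr_trans' {G : PMG V} (hG : IsAncestral G) {a b c : V}
    (hab : G.DirEdge a b) (hbc : G.Arr b c) (hac : G.Adj a c) : G.Arr a c := by
  apply hG.1.arr_of_not_dir hac
  intro h
  exact hab.not_arr (hG.arr_trans hbc h hab.adj.symm')

theorem mconn_of_open {G : PMG V} {Z : Finset V} {p : List V}
    (h : ∀ i a b c, p[i]? = some a → p[i+1]? = some b → p[i+2]? = some c → TOpen G Z a b c) :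
    MConn G Z p := by
  refine ⟨?_, ?_, ?_⟩
  · intro i hi
    have e0 : p[i]? = some p[i] := List.getElem?_eq_getElem (by omega)
    have e1 : p[i+1]? = some p[i+1] := List.getElem?_eq_getElem (by omega)
    have e2 : p[i+2]? = some p[i+2] := List.getElem?_eq_getElem (by omega)
    rcases h i _ _ _ e0 e1 e2 with ⟨h1, h2, _⟩ | ⟨h1 | h1, _⟩
    · exact Or.inl ⟨_, _, _, e0, e1, e2, h1, h2⟩
    · exact Or.inr ⟨_, _, _, e0, e1, e2, Or.inl h1⟩
    · exact Or.inr ⟨_, _, _, e0, e1, e2, Or.inr (Or.inl h1)⟩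
  · rintro i b hb ⟨a, b', c, e0, e1, e2, hm⟩
    obtain rfl : b = b' := by rw [hb] at e1; exact Option.some.inj e1
    rcases h i _ _ _ e0 e1 e2 with ⟨h1, h2, _⟩ | ⟨_, h2⟩
    · simp [Arr] at h1 h2
      simp [h1, h2] at hm
    · exact h2
  · rintro i b hb ⟨a, b', c, e0, e1, e2, m1, m2⟩
    obtain rfl : b = b' := by rw [hb] at e1; exact Option.some.inj e1
    rcases h i _ _ _ e0 e1 e2 with ⟨_, _, h3⟩ | ⟨h1 | h1, _⟩
    · exact h3
    · exact absurd h1 (Arr.not_tl m1)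
    · exact absurd h1 (Arr.not_tl m2)

theorem open_of_mconn {G : PMG V} (hG : IsMixed G) {Z : Finset V} {p : List V}
    (h : MConn G Z p) :
    ∀ i a b c, p[i]? = some a → p[i+1]? = some b → p[i+2]? = some c → TOpen G Z a b c := by
  intro i a b c e0 e1 e2
  have hi : i + 2 < p.length := by
    by_contra hh
    rw [List.getElem?_eq_none (by omega)] at e2
    cases e2
  rcases h.1 i hi with hc | hn
  · have := h.2.2 i b e1 hc
    obtain ⟨a', b', c', f0, f1, f2, m1, m2⟩ := hc
    rw [e0] at f0; rw [e1] at f1; rw [e2] at f2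
    cases f0; cases f1; cases f2
    exact Or.inl ⟨m1, m2, this⟩
  · have := h.2.1 i b e1 hn
    obtain ⟨a', b', c', f0, f1, f2, hm⟩ := hn
    rw [e0] at f0; rw [e1] at f1; rw [e2] at f2
    cases f0; cases f1; cases f2
    rcases hm with hm | hm | ⟨hm, _, _⟩
    · exact Or.inr ⟨Or.inl hm, this⟩
    · exact Or.inr ⟨Or.inr hm, this⟩
    · exfalso
      have hadj : G.Adj a b := by simp [Adj, hm]
      rcases hG.arr_or hadj with h1 | h1
      · simp [Arr, hm] at h1
      · have := h1.2; simp [hm] at this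

/-- Collider walks from `D` into a node, all of whose non-endpoint nodes are in `S`. -/
inductive CW (G : PMG V) (S : Finset V) (D : V) : V → Prop
  | base {c : V} : G.Arr D c → CW G S D c
  | step {c c' : V} : CW G S D c → c ∈ S → G.Arr c c' → G.Arr c' c → CW G S D c'

/-- Collider paths (listed backwards) from `D` into the head of the list. -/
inductive CP (G : PMG V) (S : Finset V) (D : V) : List V → Prop
  | base {c : V} : G.Arr D c → c ≠ D → CP G S D [c, D]
  | step {c c' : V} {t : List V} : CP G S D (c :: t) → c ∈ S → G.Arr c c' → G.Arr c' c →
      c' ∉ c :: t → CP G S D (c' :: c :: t)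

theorem CP.trunc {G : PMG V} {S : Finset V} {D : V} {l : List V} (h : CP G S D l) :
    ∀ x ∈ l, x ≠ D → ∃ t, CP G S D (x :: t) := by
  induction h with
  | @base c h1 h2 =>
    intro x hx hxD
    simp at hx
    rcases hx with rfl | rfl
    · exact ⟨_, CP.base h1 h2⟩
    · exact absurd rfl hxD
  | @step c c' t h1 h2 h3 h4 h5 ih =>
    intro x hx hxD
    rcases List.mem_cons.1 hx with rfl | hx
    · exact ⟨_, CP.step h1 h2 h3 h4 h5⟩
    · exact ih x hx hxD

theorem CW.toCP {G : PMG V} {S : Finset V} {D c : V} (h : CW G S D c) (hc : c ≠ D) :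
    ∃ t, CP G S D (c :: t) := by
  induction h with
  | @base c h1 => exact ⟨_, CP.base h1 hc⟩
  | @step c c' h1 h2 h3 h4 ih =>
    by_cases hcD : c = D
    · subst hcD
      exact ⟨_, CP.base h3 hc⟩
    · obtain ⟨t, ht⟩ := ih hcD
      by_cases hm : c' ∈ c :: t
      · exact ht.trunc c' hm hc
      · exact ⟨_, CP.step ht h2 h3 h4 hm⟩

theorem open_cons {G : PMG V} {S : Finset V} {a b c : V} {t : List V}
    (h : ∀ i a' b' c', (b :: c :: t)[i]? = some a' → (b :: c :: t)[i+1]? = some b' →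
      (b :: c :: t)[i+2]? = some c' → TOpen G S a' b' c') (h0 : TOpen G S a b c) :
    ∀ i a' b' c', (a :: b :: c :: t)[i]? = some a' → (a :: b :: c :: t)[i+1]? = some b' →
      (a :: b :: c :: t)[i+2]? = some c' → TOpen G S a' b' c' := by
  intro i a' b' c' e0 e1 e2
  cases i with
  | zero =>
    simp at e0 e1 e2
    subst e0; subst e1; subst e2
    exact h0
  | succ i => exact h i a' b' c' (by simpa using e0) (by simpa using e1) (by simpa using e2)

theorem CP.props {G : PMG V} {S : Finset V} {D : V} {l : List V} (h : CP G S D l) :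
    ∃ c d t, l = c :: d :: t ∧ G.Arr d c ∧ IsPath G l ∧ l.getLast? = some D ∧
      (∀ i a b c, l[i]? = some a → l[i+1]? = some b → l[i+2]? = some c → TOpen G S a b c) ∧
      (∀ x ∈ l, x = c ∨ x = D ∨ x ∈ S) := by
  induction h with
  | @base c h1 h2 =>
    refine ⟨c, D, [], rfl, h1, ⟨by simp, by simp [h2], List.isChain_pair.2 h1.adj.symm'⟩, by simp, ?_, ?_⟩
    · intro i a b c e0 e1 e2
      simp at e2
    · intro x hx; simp at hx; tauto
  | @step c c' t h1 h2 h3 h4 h5 ih =>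
    obtain ⟨c1, d, t1, he, ha, hp, hl, ho, hs⟩ := ih
    cases he
    refine ⟨c', c, _, rfl, h3, isPath_cons hp h4.adj h5, ?_, ?_, ?_⟩
    · rw [List.getLast?_cons_cons]; exact hl
    · exact open_cons ho (Or.inl ⟨h4, ha, AnZ.of_mem h2⟩)
    · intro x hx
      rcases List.mem_cons.1 hx with rfl | hx
      · exact Or.inl rfl
      · rcases hs x hx with rfl | h | h
        · exact Or.inr (Or.inr h2)
        · exact Or.inr (Or.inl h)
        · exact Or.inr (Or.inr h)

/-- Key fact: a node reached by a collider walk from `D` through `S` and adjacent to `y`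
is in the separating set `S` of `D` and `y` exactly if it is a parent of `y`. -/
theorem CW.key {G : PMG V} (hG : IsMixed G) {S : Finset V} {D y c : V}
    (hsep : MSep G y D S) (hy : y ∉ S) (hyD : y ≠ D) (hna : ¬ G.Adj y D)
    (h : CW G S D c) (hc : G.Adj c y) : c ∈ S ↔ G.DirEdge c y := by
  have hcD : c ≠ D := by
    rintro rfl
    exact hna hc.symm'
  obtain ⟨t, ht⟩ := h.toCP hcD
  obtain ⟨c1, d, t1, he, ha, hp, hl, ho, hs⟩ := ht.props
  cases he
  have hyl : y ∉ c :: d :: t1 := by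
    intro hm
    rcases hs y hm with h | h | h
    · exact hc.ne h.symm
    · exact hyD h
    · exact hy h
  have hpath : IsPathFromTo G (y :: c :: d :: t1) y D :=
    ⟨isPath_cons hp hc.symm' hyl, by simp, by rw [List.getLast?_cons_cons]; exact hl, by simp⟩
  constructor
  · intro hcS
    by_contra hnd
    exact hsep _ hpath (mconn_of_open (open_cons ho
      (Or.inl ⟨hG.arr_of_not_dir hc.symm' hnd, ha, AnZ.of_mem hcS⟩)))
  · intro hd
    by_contra hcS
    exact hsep _ hpath (mconn_of_open (open_cons ho (Or.inr ⟨Or.inl hd.2, hcS⟩)))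

theorem CW.key2 {G : PMG V} {S : Finset V} {D y c b : V}
    (hsep : MSep G y D S) (hy : y ∉ S) (hyD : y ≠ D) (hna : ¬ G.Adj y D)
    (h : CW G S D c) (hcS : c ∈ S) (hcD : c ≠ D) (hbc : G.Arr b c) (hby : G.DirEdge b y)
    : b ∈ S := by
  by_contra hbS
  obtain ⟨t, ht⟩ := h.toCP hcD
  obtain ⟨c1, d, t1, he, ha, hp, hl, ho, hs⟩ := ht.props
  cases he
  have hbl : b ∉ c :: d :: t1 := by
    intro hm
    rcases hs b hm with h | h | h
    · exact hbc.adj.ne h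
    · subst h; exact hna hby.adj.symm'
    · exact hbS h
  have hyl : y ∉ b :: c :: d :: t1 := by
    intro hm
    rcases List.mem_cons.1 hm with h | hm
    · exact hby.adj.ne h.symm
    rcases hs y hm with h | h | h
    · subst h; exact hy hcS
    · exact hyD h
    · exact hy h
  have hpath : IsPathFromTo G (y :: b :: c :: d :: t1) y D :=
    ⟨isPath_cons (isPath_cons hp hbc.adj hbl) hby.adj.symm' hyl, by simp,
      by rw [List.getLast?_cons_cons, List.getLast?_cons_cons]; exact hl, by simp⟩
  exact hsep _ hpath (mconn_of_open (open_cons (open_cons ho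
      (Or.inl ⟨hbc, ha, AnZ.of_mem hcS⟩)) (Or.inr ⟨Or.inl hby.2, hbS⟩)))

end PMG
namespace PMG

variable {V : Type}

/-- The middle node of the triple `a, b, c` has definite status. -/
def TDef (P : PMG V) (a b c : V) : Prop :=
  (P.Arr a b ∧ P.Arr c b) ∨ (P.Tl a b ∨ P.Tl c b ∨
    (P.mark a b = some Mark.circle ∧ P.mark c b = some Mark.circle ∧ ¬ P.Adj a c))

theorem TDef.symm' {P : PMG V} {a b c : V} (h : TDef P a b c) : TDef P c b a := by
  rcases h with h | h | h | h
  · exact Or.inl ⟨h.2, h.1⟩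
  · exact Or.inr (Or.inr (Or.inl h))
  · exact Or.inr (Or.inl h)
  · exact Or.inr (Or.inr (Or.inr ⟨h.2.1, h.1, fun h' => h.2.2 h'.symm'⟩))

theorem noncoll_mem {G : PMG V} {S : Finset V} {y b D : V}
    (hsep : MSep G y D S) (hyD : y ≠ D) (hyb : G.Adj y b) (hbD : G.Adj b D)
    (ht : G.Tl y b ∨ G.Tl D b) : b ∈ S := by
  by_contra hb
  refine hsep [y, b, D] ⟨⟨by simp, ?_, ?_⟩, by simp, by simp, by simp⟩ (mconn_of_open ?_)
  · simp [hyD, hyb.ne, hbD.ne]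
  · exact List.isChain_cons_cons.2 ⟨hyb, List.isChain_pair.2 hbD⟩
  · apply open_cons
    · intro i a b c e0 e1 e2
      simp at e2
    · exact Or.inr ⟨ht, hb⟩

theorem mark_cases {P : PMG V} {a b : V} (h : P.Adj a b) :
    P.Arr a b ∨ P.Tl a b ∨ P.mark a b = some Mark.circle := by
  unfold Adj at h
  rcases hm : P.mark a b with _ | m
  · simp [hm] at h
  · cases m <;> simp [Arr, Tl, hm]

section
variable {P : PMG V} {cls : Set (PMG V)}

theorem IsPAGOf.arr (hP : IsPAGOf P cls) {a b : V} (h : P.Arr a b) {M : PMG V} (hM : M ∈ cls) :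
    M.Arr a b := ((hP.2.2.2.2.2.1 a b).1 h).2 M hM

theorem IsPAGOf.tl (hP : IsPAGOf P cls) {a b : V} (h : P.Tl a b) {M : PMG V} (hM : M ∈ cls) :
    M.Tl a b := ((hP.2.2.2.2.2.2 a b).1 h).2 M hM

theorem IsPAGOf.dir (hP : IsPAGOf P cls) {a b : V} (h : P.DirEdge a b) {M : PMG V}
    (hM : M ∈ cls) : M.DirEdge a b := ⟨hP.arr h.1 hM, hP.tl h.2 hM⟩

theorem IsPAGOf.arr_of (hP : IsPAGOf P cls) {a b : V} (ha : P.Adj a b)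
    (h : ∀ M ∈ cls, M.Arr a b) : P.Arr a b := (hP.2.2.2.2.2.1 a b).2 ⟨ha, h⟩

theorem IsPAGOf.tl_of (hP : IsPAGOf P cls) {a b : V} (ha : P.Adj a b)
    (h : ∀ M ∈ cls, M.Tl a b) : P.Tl a b := (hP.2.2.2.2.2.2 a b).2 ⟨ha, h⟩

theorem IsPAGOf.adj (hP : IsPAGOf P cls) {M : PMG V} (hM : M ∈ cls) {a b : V} :
    P.Adj a b ↔ M.Adj a b := hP.2.2.2.2.1 M hM a b

theorem IsPAGOf.anc (hP : IsPAGOf P cls) {M : PMG V} (hM : M ∈ cls) : IsAncestral M :=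
  (hP.2.1 M hM).1

theorem IsPAGOf.mixed (hP : IsPAGOf P cls) {M : PMG V} (hM : M ∈ cls) : IsMixed M :=
  (hP.2.1 M hM).1.1

/-- A separating set that works for the whole class. -/
def ClsSep (cls : Set (PMG V)) (S : Finset V) (y D : V) : Prop :=
  y ∉ S ∧ y ≠ D ∧ ∀ M ∈ cls, ¬ M.Adj y D ∧ MSep M y D S

theorem IsPAGOf.sep (hP : IsPAGOf P cls) {y D : V} (hyD : y ≠ D) (hna : ¬ P.Adj y D) :
    ∃ S, ClsSep cls S y D := by
  obtain ⟨M, hM⟩ := hP.1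
  obtain ⟨S, h1, h2, h3⟩ := (hP.2.1 M hM).2 y D hyD (fun h => hna ((hP.adj hM).2 h))
  exact ⟨S, h1, hyD, fun M' hM' => ⟨fun h => hna ((hP.adj hM').2 h),
    (hP.2.2.2.1 M hM M' hM' y D S hyD h1 h2).1 h3⟩⟩

theorem ClsSep.key (hP : IsPAGOf P cls) {S : Finset V} {y D c : V} (hS : ClsSep cls S y D)
    {M : PMG V} (hM : M ∈ cls) (h : CW M S D c) (hc : M.Adj c y) : c ∈ S ↔ M.DirEdge c y :=
  h.key (hP.mixed hM) (hS.2.2 M hM).2 hS.1 hS.2.1 (hS.2.2 M hM).1 hc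

theorem ClsSep.key2 {S : Finset V} {y D c b : V} (hS : ClsSep cls S y D)
    {M : PMG V} (hM : M ∈ cls) (h : CW M S D c) (hcS : c ∈ S) (hc : M.Adj c y)
    (hbc : M.Arr b c) (hby : M.DirEdge b y) : b ∈ S :=
  h.key2 (hS.2.2 M hM).2 hS.1 hS.2.1 (hS.2.2 M hM).1 hcS
    (by rintro rfl; exact (hS.2.2 M hM).1 hc.symm') hbc hby

theorem unshielded (hP : IsPAGOf P cls) {a b c : V} (hac : a ≠ c) (hna : ¬ P.Adj a c)
    (hab : P.Adj a b) (hcb : P.Adj c b) : TDef P a b c := by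
  obtain ⟨S, hS⟩ := hP.sep hac.symm (fun h => hna h.symm')
  by_cases hb : b ∈ S
  · have key : ∀ M ∈ cls, M.Arr a b → M.Tl c b := by
      intro M hM h
      exact ((hS.key hP hM (CW.base h) ((hP.adj hM).1 hcb.symm')).1 hb).2
    rcases mark_cases hab with h | h | h
    · exact Or.inr (Or.inr (Or.inl (hP.tl_of hcb fun M hM => key M hM (hP.arr h hM))))
    · exact Or.inr (Or.inl h)
    · rcases mark_cases hcb with h' | h' | h'
      · refine Or.inr (Or.inl (hP.tl_of hab fun M hM => ?_))
        rcases (hP.mixed hM).arr_or ((hP.adj hM).1 hab) with h1 | h1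
        · exact absurd (key M hM h1) (hP.arr h' hM).not_tl
        · exact h1.2
      · exact Or.inr (Or.inr (Or.inl h'))
      · exact Or.inr (Or.inr (Or.inr ⟨h, h', hna⟩))
  · have key : ∀ M ∈ cls, ¬ M.Tl c b ∧ ¬ M.Tl a b := by
      intro M hM
      have := noncoll_mem (hS.2.2 M hM).2 hac.symm ((hP.adj hM).1 hcb) ((hP.adj hM).1 hab.symm')
      exact ⟨fun h => hb (this (Or.inl h)), fun h => hb (this (Or.inr h))⟩
    refine Or.inl ⟨hP.arr_of hab fun M hM => ?_, hP.arr_of hcb fun M hM => ?_⟩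
    · exact (hP.mixed hM).arr_of_not_dir ((hP.adj hM).1 hab) fun h => (key M hM).2 h.2
    · exact (hP.mixed hM).arr_of_not_dir ((hP.adj hM).1 hcb) fun h => (key M hM).1 h.2

/-- A collider of definite status is a collider in the PAG. -/
theorem coll_of_tdef (hP : IsPAGOf P cls) {M : PMG V} (hM : M ∈ cls) {a b c : V} (hac : a ≠ c)
    (hd : TDef P a b c) (h1 : M.Arr a b) (h2 : M.Arr c b) : P.Arr a b ∧ P.Arr c b := by
  rcases hd with h | h | h | ⟨h3, h4, h5⟩
  · exact h
  · exact absurd (hP.tl h hM) h1.not_tl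
  · exact absurd (hP.tl h hM) h2.not_tl
  · exfalso
    obtain ⟨S, hS⟩ := hP.sep hac.symm (fun h => h5 h.symm')
    have hab := (hP.adj hM).2 h1.adj
    have hcb := (hP.adj hM).2 h2.adj
    have hb : b ∉ S := fun hb =>
      h2.not_tl ((hS.key hP hM (CW.base h1) h2.adj.symm').1 hb).2
    have hA : P.Arr a b := by
      refine hP.arr_of hab fun M' hM' => ?_
      refine (hP.mixed hM').arr_of_not_dir ((hP.adj hM').1 hab) fun h => hb ?_
      exact noncoll_mem (hS.2.2 M' hM').2 hac.symm ((hP.adj hM').1 hcb)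
        ((hP.adj hM').1 hab.symm') (Or.inr h.2)
    simp [Arr, h3] at hA

theorem disc (hP : IsPAGOf P cls) {S : Finset V} {y D c b : V} (hS : ClsSep cls S y D)
    (hcw : ∀ M ∈ cls, CW M S D c) (hcS : c ∈ S) (hcy : ∀ M ∈ cls, M.DirEdge c y)
    (hbc : P.Arr b c) (hby : P.Adj b y) : TDef P c b y := by
  by_cases hb : b ∈ S
  · refine Or.inr (Or.inr (Or.inl (hP.tl_of hby.symm' fun M hM => ?_)))
    have hby' := (hP.adj hM).1 hby
    rcases (hP.mixed hM).arr_or (hP.arr hbc hM).adj.symm' with h | h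
    · exact ((hS.key hP hM (CW.step (hcw M hM) hcS h (hP.arr hbc hM)) hby').1 hb).2
    · exact ((hP.anc hM).dir_trans h (hcy M hM) hby').2
  · have key : ∀ M ∈ cls, M.Arr c b ∧ M.Arr y b := by
      intro M hM
      have hby' := (hP.adj hM).1 hby
      rcases (hP.mixed hM).arr_or (hP.arr hbc hM).adj.symm' with h | h
      · refine ⟨h, (hP.mixed hM).arr_of_not_dir hby'.symm' fun hd => hb ?_⟩
        exact (hS.key hP hM (CW.step (hcw M hM) hcS h (hP.arr hbc hM)) hby').2 hd
      · exact absurd (hS.key2 hM (hcw M hM) hcS (hcy M hM).adj (hP.arr hbc hM)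
          ((hP.anc hM).dir_trans h (hcy M hM) hby')) hb
    exact Or.inl ⟨hP.arr_of hbc.adj.symm' fun M hM => (key M hM).1,
      hP.arr_of hby.symm' fun M hM => (key M hM).2⟩

/-- Propagating along a discriminating path. -/
theorem chain_cw (hP : IsPAGOf P cls) {S : Finset V} {y D : V} (hS : ClsSep cls S y D)
    {M : PMG V} (hM : M ∈ cls) (f : ℕ → V) (m : ℕ) (h1 : ∀ M' ∈ cls, CW M' S D (f 1))
    (hf : ∀ l, 1 ≤ l → l < m → P.Arr (f l) (f (l+1)) ∧ P.Arr (f (l+1)) (f l))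
    (hfy : ∀ l, 1 ≤ l → l ≤ m → M.DirEdge (f l) y) :
    ∀ l, 1 ≤ l → l ≤ m → (∀ M' ∈ cls, CW M' S D (f l)) ∧ f l ∈ S ∧
      ∀ M' ∈ cls, M'.DirEdge (f l) y := by
  have aux : ∀ l, 1 ≤ l → l ≤ m → (∀ M' ∈ cls, CW M' S D (f l)) → (f l ∈ S ∧
      ∀ M' ∈ cls, M'.DirEdge (f l) y) := by
    intro l hl hlm hcw
    have hin : f l ∈ S := (hS.key hP hM (hcw M hM) (hfy l hl hlm).adj).2 (hfy l hl hlm)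
    refine ⟨hin, fun M' hM' => (hS.key hP hM' (hcw M' hM') ?_).1 hin⟩
    exact (hP.adj hM').1 ((hP.adj hM).2 (hfy l hl hlm).adj)
  intro l hl
  induction l, hl using Nat.le_induction with
  | base => exact fun hm => ⟨h1, aux 1 le_rfl hm h1⟩
  | succ l hl ih =>
    intro hlm
    obtain ⟨i1, i2, i3⟩ := ih (by omega)
    have hcw : ∀ M' ∈ cls, CW M' S D (f (l+1)) := fun M' hM' =>
      CW.step (i1 M' hM') i2 (hP.arr (hf l hl (by omega)).1 hM')
        (hP.arr (hf l hl (by omega)).2 hM')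
    exact ⟨hcw, aux (l+1) (by omega) hlm hcw⟩

/-- `x → y` visible in the PAG, witnessed by the sequence `d 0, …, d n = x`. -/
structure VisSeq (P : PMG V) (x y : V) (d : ℕ → V) (n : ℕ) : Prop where
  pos : 1 ≤ n
  last : d n = x
  ne : y ≠ d 0
  nadj : ¬ P.Adj y (d 0)
  fwd : ∀ k, k < n → P.Arr (d k) (d (k+1))
  bwd : ∀ k, 1 ≤ k → k < n → P.Arr (d (k+1)) (d k)
  par : ∀ k, 1 ≤ k → k ≤ n → P.DirEdge (d k) y

theorem Visible.seq {x y : V} (h : Visible P x y) : ∃ d n, VisSeq P x y d n := by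
  obtain ⟨hd, v, hvy, hna, h⟩ := h
  rcases h with h | ⟨p, ⟨⟨hp0, hp1, hp2⟩, hh, hl, hlen⟩, hc, ⟨a, ha, hax⟩, hpar⟩
  · refine ⟨fun k => if k = 0 then v else x, 1, le_rfl, by simp, by simpa using hvy.symm,
      by simpa using fun h' => hna (Adj.symm' h'), ?_, ?_, ?_⟩
    · intro k hk
      obtain rfl : k = 0 := by omega
      simpa using h
    · intro k h1 h2; omega
    · intro k h1 h2
      obtain rfl : k = 1 := by omega
      simpa using hd
  · have hg : ∀ k, k < p.length → p[k]? = some (p.getD k v) := by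
      intro k hk
      simp [List.getElem?_eq_getElem hk]
    have h0 : p.getD 0 v = v := by
      rw [List.head?_eq_getElem?, hg 0 (by omega)] at hh
      exact Option.some.inj hh
    have hlast : p.getD (p.length - 1) v = x := by
      rw [List.getLast?_eq_getElem?, hg _ (by omega)] at hl
      exact Option.some.inj hl
    have hcol : ∀ k, k + 2 < p.length → P.Arr (p.getD k v) (p.getD (k+1) v) ∧
        P.Arr (p.getD (k+2) v) (p.getD (k+1) v) := by
      intro k hk
      obtain ⟨a, b, c, e0, e1, e2, m1, m2⟩ := hc k hk
      rw [hg _ (by omega)] at e0 e1 e2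
      cases e0; cases e1; cases e2
      exact ⟨m1, m2⟩
    have hinj : ∀ i j, i < p.length → j < p.length → p.getD i v = p.getD j v → i = j := by
      intro i j hi hj he
      refine (List.getElem?_inj hi hp1).1 ?_
      rw [hg i hi, hg j hj, he]
    refine ⟨fun k => p.getD k v, p.length - 1, by omega, hlast, ?_, ?_, ?_, ?_, ?_⟩
    · simp only [h0]; exact hvy.symm
    · simp only [h0]; exact fun h' => hna (Adj.symm' h')
    · intro k hk
      by_cases hk2 : k + 2 < p.length
      · exact (hcol k hk2).1
      · obtain rfl : k = p.length - 2 := by omega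
        rw [hg _ (by omega)] at ha
        have e : p.length - 2 + 1 = p.length - 1 := by omega
        simp only [e, hlast, Option.some.inj ha]
        exact hax
    · intro k h1 h2
      have := (hcol (k-1) (by omega)).2
      have e1 : k - 1 + 2 = k + 1 := by omega
      have e2 : k - 1 + 1 = k := by omega
      rw [e1, e2] at this
      exact this
    · intro k h1 h2
      by_cases hk : k = p.length - 1
      · subst hk; simp only [hlast]; exact hd
      · apply hpar
        · have := hg k (by omega)
          exact List.mem_of_getElem? this
        · intro he
          have := hinj k 0 (by omega) (by omega) (by rw [h0]; exact he)
          omega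
        · intro he
          exact hk (hinj k _ (by omega) (by omega) (by rw [hlast]; exact he))

theorem VisSeq.cw (hP : IsPAGOf P cls) {x y : V} {d : ℕ → V} {n : ℕ}
    (hv : VisSeq P x y d n) {S : Finset V} (hS : ClsSep cls S y (d 0)) :
    ∀ l, 1 ≤ l → l ≤ n → (∀ M' ∈ cls, CW M' S (d 0) (d l)) ∧ d l ∈ S ∧
      ∀ M' ∈ cls, M'.DirEdge (d l) y := by
  obtain ⟨M, hM⟩ := hP.1
  exact chain_cw hP hS hM d n (fun M' hM' => CW.base (hP.arr (hv.fwd 0 hv.pos) hM'))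
    (fun l h1 h2 => ⟨hv.fwd l h2, hv.bwd l h1 h2⟩)
    (fun l h1 h2 => hP.dir (hv.par l h1 h2) hM)

theorem vis_consistent (hP : IsPAGOf P cls) {x y b : V} {d : ℕ → V} {n : ℕ}
    (hv : VisSeq P x y d n) {S : Finset V} (hS : ClsSep cls S y (d 0))
    (hbx : P.Adj b x) (hby : P.Adj b y) {M : PMG V} (hM : M ∈ cls) (hbM : M.Arr b x)
    {M' : PMG V} (hM' : M' ∈ cls) : b ∈ S ↔ M'.DirEdge b y := by
  by_contra hinc
  have hby' := (hP.adj hM').1 hby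
  have hbx' := (hP.adj hM').1 hbx
  have hncw : ¬ CW M' S (d 0) b := fun h => hinc (hS.key hP hM' h hby')
  have hcw := hv.cw hP hS
  have han := hP.anc hM'
  have hx := hcw n hv.pos le_rfl
  rw [hv.last] at hx
  have hxb : M'.DirEdge x b := by
    rcases han.1.arr_or hbx' with h | h
    · rcases han.1.arr_or hbx'.symm' with h' | h'
      · exact absurd (CW.step (hx.1 M' hM') hx.2.1 h' h) hncw
      · exfalso
        have hd := han.dir_trans h' (hx.2.2 M' hM') hby'
        exact hinc (iff_of_true
          (hS.key2 hM' (hx.1 M' hM') hx.2.1 (hx.2.2 M' hM').adj h hd) hd)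
    · exact h
  have hne : ∀ k, k ≤ n → d k ≠ b := by
    intro k hk he
    rcases Nat.eq_zero_or_pos k with rfl | hk0
    · rw [he] at hS
      exact (hS.2.2 M' hM').1 hby'.symm'
    · have := hcw k hk0 hk
      rw [he] at this
      exact hinc (iff_of_true this.2.1 (this.2.2 M' hM'))
  have step : ∀ k, k < n → (∀ l, k + 1 ≤ l → l ≤ n → M'.DirEdge (d l) b) →
      1 ≤ k ∧ M'.DirEdge (d k) b := by
    intro k hk hl
    by_cases hadj : P.Adj (d k) b
    · have hkb : M'.Arr (d k) b := han.arr_trans (hP.arr (hv.fwd k hk) hM')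
        (hl (k+1) le_rfl hk) ((hP.adj hM').1 hadj)
      rcases Nat.eq_zero_or_pos k with rfl | hk0
      · exact absurd (CW.base hkb) hncw
      · refine ⟨hk0, ?_⟩
        obtain ⟨c1, c2, c3⟩ := hcw k hk0 hk.le
        rcases han.1.arr_or hkb.adj.symm' with h | h
        · exact absurd (CW.step (c1 M' hM') c2 hkb h) hncw
        · exact h
    · exfalso
      obtain ⟨T, hT⟩ := hP.sep (hne k hk.le).symm (fun h => hadj h.symm')
      have hch := chain_cw hP hT hM' (fun l => d (k + l)) (n - k)
        (fun M1 hM1 => CW.base (hP.arr (hv.fwd k hk) hM1))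
        (fun l h1 h2 => ⟨hv.fwd (k+l) (by omega), hv.bwd (k+l) (by omega) (by omega)⟩)
        (fun l h1 h2 => hl (k+l) (by omega) (by omega)) (n-k) (by omega) le_rfl
      have e : k + (n - k) = n := by omega
      simp only [e, hv.last] at hch
      exact (hch.2.2 M hM).not_arr hbM
  have all : ∀ t, t < n → ∀ l, n - t ≤ l → l ≤ n → M'.DirEdge (d l) b := by
    intro t
    induction t with
    | zero =>
      intro _ l h1 h2
      obtain rfl : l = n := by omega
      rw [hv.last]; exact hxb
    | succ t ih =>
      intro ht l h1 h2
      by_cases hl : n - t ≤ l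
      · exact ih (by omega) l hl h2
      · refine (step l (by omega) fun l' h3 h4 => ih (by omega) l' (by omega) h4).2
  have := (step 0 hv.pos fun l h1 h2 => all (n-1) (by have := hv.pos; omega) l (by omega) h2).1
  omega

theorem vis_disc (hP : IsPAGOf P cls) {x y b : V} (hv : Visible P x y)
    (hbx : P.Adj b x) (hby : P.Adj b y) {M : PMG V} (hM : M ∈ cls) (hbM : M.Arr b x) :
    TDef P x b y := by
  obtain ⟨d, n, hd⟩ := hv.seq
  obtain ⟨S, hS⟩ := hP.sep hd.ne hd.nadj
  have key := fun M' hM' => vis_consistent hP hd hS hbx hby hM hbM (M' := M') hM'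
  by_cases hb : b ∈ S
  · exact Or.inr (Or.inr (Or.inl (hP.tl_of hby.symm' fun M' hM' => ((key M' hM').1 hb).2)))
  · have hy : ∀ M' ∈ cls, M'.Arr y b := fun M' hM' =>
      (hP.mixed hM').arr_of_not_dir ((hP.adj hM').1 hby.symm') fun h => hb ((key M' hM').2 h)
    exact Or.inl ⟨hP.arr_of hbx.symm' fun M' hM' =>
      (hP.anc hM').arr_trans' (hP.dir hv.1 hM') (hy M' hM') ((hP.adj hM').1 hbx.symm'),
      hP.arr_of hby.symm' hy⟩

/-- Discriminating path whose first node is not adjacent to `y`. -/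
theorem disc_path (hP : IsPAGOf P cls) {y b : V} {M : PMG V} (hM : M ∈ cls)
    (f : ℕ → V) (m : ℕ) (hm : 1 ≤ m) (hy : y ≠ f 0) (hna : ¬ P.Adj y (f 0))
    (h0 : P.Arr (f 0) (f 1))
    (hf : ∀ l, 1 ≤ l → l < m → P.Arr (f l) (f (l+1)) ∧ P.Arr (f (l+1)) (f l))
    (hfy : ∀ l, 1 ≤ l → l ≤ m → M.DirEdge (f l) y)
    (hb : P.Arr b (f m)) (hby : P.Adj b y) : TDef P (f m) b y := by
  obtain ⟨S, hS⟩ := hP.sep hy hna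
  obtain ⟨h1, h2, h3⟩ := chain_cw hP hS hM f m (fun M' hM' => CW.base (hP.arr h0 hM')) hf hfy
    m hm le_rfl
  exact disc hP hS h1 h2 h3 hb hby

/-- Discriminating path extended by a visible edge out of its first node. -/
theorem disc_path_vis (hP : IsPAGOf P cls) {y b : V} {M : PMG V} (hM : M ∈ cls)
    (f : ℕ → V) (m : ℕ) (hm : 1 ≤ m) (hv : Visible P (f 0) y)
    (hf : ∀ l, l < m → P.Arr (f l) (f (l+1)) ∧ P.Arr (f (l+1)) (f l))
    (hfy : ∀ l, 1 ≤ l → l ≤ m → M.DirEdge (f l) y)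
    (hb : P.Arr b (f m)) (hby : P.Adj b y) : TDef P (f m) b y := by
  obtain ⟨d, n, hd⟩ := hv.seq
  obtain ⟨S, hS⟩ := hP.sep hd.ne hd.nadj
  obtain ⟨c1, c2, c3⟩ := hd.cw hP hS n hd.pos le_rfl
  rw [hd.last] at c1 c2 c3
  obtain ⟨h1, h2, h3⟩ := chain_cw hP hS hM f m
    (fun M' hM' => CW.step (c1 M' hM') c2 (hP.arr (hf 0 hm).1 hM') (hP.arr (hf 0 hm).2 hM'))
    (fun l _ h => hf l h) hfy m hm le_rfl
  exact disc hP hS h1 h2 h3 hb hby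

end
end PMG
namespace PMG

variable {V : Type}

/-- Index-based data about the shortest path `v 0, …, v n`. -/
structure Setup (P M : PMG V) (Z : Finset V) (v : ℕ → V) (n : ℕ) : Prop where
  adj : ∀ k, k < n → M.Adj (v k) (v (k+1))
  inj : ∀ i j, i ≤ n → j ≤ n → v i = v j → i = j
  opn : ∀ k, k + 2 ≤ n → TOpen M Z (v k) (v (k+1)) (v (k+2))
  nc : ∃ k, k < n ∧ M.Arr (v (k+1)) (v k)
  skip : ∀ j m, j + 1 < m → m ≤ n → M.Adj (v j) (v m) →
    (∀ k, k + 1 = j → TOpen M Z (v k) (v j) (v m)) →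
    (m < n → TOpen M Z (v j) (v m) (v (m+1))) →
    (∀ k, k < j → ¬ M.Arr (v (k+1)) (v k)) ∧ ¬ M.Arr (v m) (v j) ∧
      ∀ k, m ≤ k → k < n → ¬ M.Arr (v (k+1)) (v k)
  forb : ∀ j m, j < m → m ≤ n → P.Adj (v j) (v m) →
    (∀ k, k < j → ¬ P.Arr (v (k+1)) (v k)) → ¬ P.Arr (v m) (v j) →
    (∀ k, m ≤ k → k < n → ¬ P.Arr (v (k+1)) (v k)) →
    (∀ k, 1 ≤ k → (k ≤ j ∨ (m ≤ k ∧ k ≤ n)) → ¬ AnZ M Z (v k)) ∧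
      (j = 0 → Visible P (v 0) (v m))

/-- The list `p` with the nodes strictly between positions `j` and `m` removed. -/
def skipList (p : List V) (j m : ℕ) : List V := p.take (j+1) ++ p.drop m

/-- The index map of `skipList`. -/
def skipIdx (v : ℕ → V) (j m k : ℕ) : V := if k ≤ j then v k else v (k - (j+1) + m)

theorem skip_get {p : List V} {v : ℕ → V} {n : ℕ} (hlen : p.length = n + 1)
    (hv : ∀ k, k ≤ n → p[k]? = some (v k)) {j m : ℕ} (hjm : j < m) (hm : m ≤ n) (k : ℕ)
    (hk : k ≤ j + (n + 1 - m)) : (skipList p j m)[k]? = some (skipIdx v j m k) := by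
  unfold skipList skipIdx
  split_ifs with h
  · rw [List.getElem?_append_left (by simp; omega), List.getElem?_take_of_lt (by omega)]
    exact hv k (by omega)
  · have hl : (p.take (j+1)).length = j + 1 := by simp; omega
    rw [List.getElem?_append_right (by omega), hl, List.getElem?_drop, add_comm]
    exact hv _ (by omega)

theorem skip_length {p : List V} {n : ℕ} (hlen : p.length = n + 1) {j m : ℕ} (hjm : j < m)
    (hm : m ≤ n) : (skipList p j m).length = j + (n + 1 - m) + 1 := by
  simp [skipList]; omega

theorem skip_proper {G : PMG V} {X Y : Finset V} {p : List V} {v : ℕ → V} {n : ℕ}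
    (hlen : p.length = n + 1) (hv : ∀ k, k ≤ n → p[k]? = some (v k)) (hp : ProperPath G X Y p)
    {j m : ℕ} (hjm : j < m) (hm : m ≤ n) (ha : G.Adj (v j) (v m)) :
    ProperPath G X Y (skipList p j m) := by
  obtain ⟨⟨h1, h2, h3⟩, ⟨a, haX, hh⟩, ⟨b, hbY, hl⟩, ht⟩ := hp
  have hsub : (skipList p j m).Sublist p := by
    conv_rhs => rw [← List.take_append_drop (j+1) p]
    unfold skipList
    exact (List.Sublist.refl _).append (List.drop_sublist_drop_left p (by omega))
  have hlen' := skip_length hlen hjm hm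
  have hne : skipList p j m ≠ [] := by
    intro h; rw [h] at hlen'; simp at hlen'
  have hhead : (skipList p j m).head? = p.head? := by
    rw [List.head?_eq_getElem?, List.head?_eq_getElem?, skip_get hlen hv hjm hm 0 (by omega),
      hv 0 (by omega)]
    simp [skipIdx]
  refine ⟨⟨hne, hsub.nodup h2, ?_⟩, ⟨a, haX, by rw [hhead]; exact hh⟩, ⟨b, hbY, ?_⟩, ?_⟩
  · refine List.isChain_append.2 ⟨h3.take _, h3.drop _, ?_⟩
    intro x hx y hy
    rw [List.getLast?_eq_getElem?] at hx
    have hl' : (p.take (j+1)).length = j + 1 := by simp; omega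
    rw [hl', List.getElem?_take_of_lt (by omega)] at hx
    rw [List.head?_eq_getElem?, List.getElem?_drop] at hy
    simp only [Nat.add_sub_cancel, hv j (by omega), Nat.add_zero, hv m hm, Option.mem_def,
      Option.some.injEq] at hx hy
    rw [← hx, ← hy]; exact ha
  · rw [← hl, List.getLast?_eq_getElem?, List.getLast?_eq_getElem?, hlen',
      skip_get hlen hv hjm hm _ (by omega), hlen, hv _ (by omega)]
    unfold skipIdx
    rw [if_neg (by omega)]
    congr 2
    omega
  · intro c hc
    apply ht
    exact (hsub.tail).subset hc

theorem skip_possDir {G : PMG V} {p : List V} {v : ℕ → V} {n : ℕ}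
    (hlen : p.length = n + 1) (hv : ∀ k, k ≤ n → p[k]? = some (v k))
    {j m : ℕ} (hjm : j < m) (hm : m ≤ n) :
    PossDirAlong G (skipList p j m) ↔
      ((∀ k, k < j → ¬ G.Arr (v (k+1)) (v k)) ∧ ¬ G.Arr (v m) (v j) ∧
      ∀ k, m ≤ k → k < n → ¬ G.Arr (v (k+1)) (v k)) := by
  have hg := skip_get hlen hv hjm hm
  have hlen' := skip_length hlen hjm hm
  constructor
  · intro h
    have h' : ∀ k, k + 1 ≤ j + (n + 1 - m) →
        ¬ G.Arr (skipIdx v j m (k+1)) (skipIdx v j m k) := fun k hk =>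
      h k _ _ (hg k (by omega)) (hg (k+1) hk)
    refine ⟨fun k hk => ?_, ?_, fun k h1 h2 => ?_⟩
    · have := h' k (by omega)
      rwa [skipIdx, skipIdx, if_pos (by omega), if_pos (by omega)] at this
    · have := h' j (by omega)
      rw [skipIdx, skipIdx, if_neg (by omega), if_pos (by omega)] at this
      simpa using this
    · have := h' (k - m + j + 1) (by omega)
      rw [skipIdx, skipIdx, if_neg (by omega), if_neg (by omega)] at this
      have e1 : k - m + j + 1 + 1 - (j + 1) + m = k + 1 := by omega
      have e2 : k - m + j + 1 - (j + 1) + m = k := by omega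
      rwa [e1, e2] at this
  · rintro ⟨h1, h2, h3⟩ k a b ea eb
    have hk : k + 1 < (skipList p j m).length := by
      by_contra hh
      rw [List.getElem?_eq_none (by omega)] at eb
      cases eb
    rw [hg k (by omega)] at ea
    rw [hg (k+1) (by omega)] at eb
    cases ea; cases eb
    unfold skipIdx
    rcases lt_trichotomy k j with hkj | hkj | hkj
    · rw [if_pos (by omega), if_pos (by omega)]; exact h1 k hkj
    · subst hkj
      rw [if_neg (by omega), if_pos (by omega)]
      simpa using h2
    · rw [if_neg (by omega), if_neg (by omega)]
      have e1 : k + 1 - (j + 1) + m = (k - (j+1) + m) + 1 := by omega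
      rw [e1]
      exact h3 _ (by omega) (by omega)

theorem skip_mconn {G : PMG V} {Z : Finset V} {p : List V} {v : ℕ → V} {n : ℕ}
    (hlen : p.length = n + 1) (hv : ∀ k, k ≤ n → p[k]? = some (v k))
    (hopn : ∀ k, k + 2 ≤ n → TOpen G Z (v k) (v (k+1)) (v (k+2)))
    {j m : ℕ} (hjm : j < m) (hm : m ≤ n)
    (h1 : ∀ k, k + 1 = j → TOpen G Z (v k) (v j) (v m))
    (h2 : m < n → TOpen G Z (v j) (v m) (v (m+1))) : MConn G Z (skipList p j m) := by
  have hg := skip_get hlen hv hjm hm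
  have hlen' := skip_length hlen hjm hm
  apply mconn_of_open
  intro k a b c ea eb ec
  have hk : k + 2 < (skipList p j m).length := by
    by_contra hh
    rw [List.getElem?_eq_none (by omega)] at ec
    cases ec
  rw [hg k (by omega)] at ea
  rw [hg (k+1) (by omega)] at eb
  rw [hg (k+2) (by omega)] at ec
  cases ea; cases eb; cases ec
  unfold skipIdx
  rcases lt_trichotomy (k+1) j with hkj | hkj | hkj
  · rw [if_pos (by omega), if_pos (by omega), if_pos (by omega)]
    exact hopn k (by omega)
  · rw [if_pos (by omega), if_pos (by omega), if_neg (by omega)]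
    have e : k + 2 - (j+1) + m = m := by omega
    rw [e, hkj]
    exact h1 k hkj
  · rcases Nat.lt_or_ge j k with hjk | hjk
    · rw [if_neg (by omega), if_neg (by omega), if_neg (by omega)]
      have e1 : k + 1 - (j + 1) + m = (k - (j+1) + m) + 1 := by omega
      have e2 : k + 2 - (j + 1) + m = (k - (j+1) + m) + 2 := by omega
      rw [e1, e2]
      exact hopn _ (by omega)
    · obtain rfl : k = j := by omega
      rw [if_pos (by omega), if_neg (by omega), if_neg (by omega)]
      have e1 : k + 1 - (k + 1) + m = m := by omega
      have e2 : k + 2 - (k + 1) + m = m + 1 := by omega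
      rw [e1, e2]
      exact h2 (by omega)

theorem possDesc_of_desc {P : PMG V} {cls : Set (PMG V)} (hP : IsPAGOf P cls) {M : PMG V}
    (hM : M ∈ cls) {a b : V} (h : Descendant M a b) : PossDescendant P a b := by
  obtain ⟨p, ⟨h1, h2, h3⟩, hd, hh, hl⟩ := h
  refine ⟨p, ⟨h1, h2, ?_⟩, ?_, hh, hl⟩
  · exact h3.imp fun a b h => (hP.adj hM).2 h
  · intro i a b ea eb hm
    exact (hd i a b ea eb).not_arr (hP.arr hm hM)

theorem proper_iff {P : PMG V} {cls : Set (PMG V)} (hP : IsPAGOf P cls) {M : PMG V}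
    (hM : M ∈ cls) {X Y : Finset V} {p : List V} (h : ProperPath M X Y p) :
    ProperPath P X Y p := by
  obtain ⟨⟨h1, h2, h3⟩, h⟩ := h
  exact ⟨⟨h1, h2, h3.imp fun a b h => (hP.adj hM).2 h⟩, h⟩

theorem exists_setup {P : PMG V} {cls : Set (PMG V)} (hP : IsPAGOf P cls) {M : PMG V}
    (hM : M ∈ cls) {X Y Z : Finset V} (hAm : Amenable P (Visible P) X Y)
    (hZforb : ∀ z ∈ Z, z ∉ Forb P X Y) (p : List V)
    (hprop : ProperPath M X Y p) (hnc : ¬ PossDirAlong M p) (hmc : MConn M Z p)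
    (hshort : ∀ q, ProperPath M X Y q → ¬ PossDirAlong M q → MConn M Z q →
      p.length ≤ q.length) :
    ∃ v n, p.length = n + 1 ∧ (∀ k, k ≤ n → p[k]? = some (v k)) ∧ Setup P M Z v n := by
  obtain ⟨a0, ha0, hh⟩ := hprop.2.1
  obtain ⟨n, hlen⟩ : ∃ n, p.length = n + 1 :=
    ⟨p.length - 1, by have := List.length_pos_iff.2 hprop.1.1; omega⟩
  have hv : ∀ k, k ≤ n → p[k]? = some (p.getD k a0) := by
    intro k hk
    simp [List.getElem?_eq_getElem (show k < p.length by omega)]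
  refine ⟨fun k => p.getD k a0, n, hlen, hv, ?_⟩
  generalize hvv : (fun k => p.getD k a0) = v
  have hv : ∀ k, k ≤ n → p[k]? = some (v k) := by rw [← hvv]; exact hv
  clear hvv
  have hget : ∀ k a, p[k]? = some a → k ≤ n ∧ v k = a := by
    intro k a h
    have hk : k ≤ n := by
      by_contra hh
      rw [List.getElem?_eq_none (by omega)] at h
      cases h
    rw [hv k hk] at h
    exact ⟨hk, Option.some.inj h⟩
  have hopn : ∀ k, k + 2 ≤ n → TOpen M Z (v k) (v (k+1)) (v (k+2)) := fun k hk =>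
    open_of_mconn (hP.mixed hM) hmc k _ _ _ (hv k (by omega)) (hv _ (by omega)) (hv _ hk)
  refine ⟨?_, ?_, hopn, ?_, ?_, ?_⟩
  · intro k hk
    have := List.isChain_iff_getElem.1 hprop.1.2.2 k (by omega)
    have e1 := hv k (by omega)
    have e2 := hv (k+1) (by omega)
    rw [List.getElem?_eq_getElem (by omega)] at e1 e2
    rw [← Option.some.inj e1, ← Option.some.inj e2]
    exact this
  · intro i j hi hj he
    refine (List.getElem?_inj (by omega) hprop.1.2.1).1 ?_
    rw [hv i hi, hv j hj, he]
  · unfold PossDirAlong at hnc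
    push Not at hnc
    obtain ⟨k, a, b, ea, eb, h⟩ := hnc
    obtain ⟨h1, rfl⟩ := hget _ _ ea
    obtain ⟨h2, rfl⟩ := hget _ _ eb
    exact ⟨k, h2, h⟩
  · intro j m hjm hm ha h1 h2
    rw [← skip_possDir hlen hv (by omega) hm]
    by_contra hq
    have := hshort _ (skip_proper hlen hv hprop (by omega) hm ha) hq
      (skip_mconn hlen hv hopn (by omega) hm h1 h2)
    rw [skip_length hlen (by omega) hm] at this
    omega
  · intro j m hjm hm ha h1 h2 h3
    have hpp := skip_proper hlen hv (proper_iff hP hM hprop) hjm hm ha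
    have hpd := (skip_possDir (G := P) hlen hv hjm hm).2 ⟨h1, h2, h3⟩
    have hg := skip_get hlen hv hjm hm
    constructor
    · rintro k hk hkk ⟨z, hz, hd⟩
      refine hZforb z hz ⟨v k, ?_, ⟨_, hpp, hpd, ?_⟩, possDesc_of_desc hP hM hd⟩
      · apply hprop.2.2.2
        have : p.tail[k-1]? = some (v k) := by
          rw [List.getElem?_tail, Nat.sub_add_cancel hk]
          exact hv k (by omega)
        exact List.mem_of_getElem? this
      · rcases hkk with hkk | hkk
        · have := hg k (by omega)
          rw [skipIdx, if_pos hkk] at this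
          exact List.mem_of_getElem? this
        · have := hg (k - m + j + 1) (by omega)
          rw [skipIdx, if_neg (by omega)] at this
          have e : k - m + j + 1 - (j + 1) + m = k := by omega
          rw [e] at this
          exact List.mem_of_getElem? this
    · rintro rfl
      obtain ⟨a, b, ea, eb, hvis⟩ := hAm _ hpp hpd
      rw [hg 0 (by omega)] at ea
      rw [hg 1 (by omega)] at eb
      simp [skipIdx] at ea eb
      rw [ea, eb]; exact hvis

end PMG

namespace PMG

variable {V : Type} {P M : PMG V} {cls : Set (PMG V)} {Z : Finset V} {v : ℕ → V} {n : ℕ}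

theorem TOpen.symm' {a b c : V} (h : TOpen M Z a b c) : TOpen M Z c b a := by
  rcases h with ⟨h1, h2, h3⟩ | ⟨h1, h2⟩
  · exact Or.inl ⟨h2, h1, h3⟩
  · exact Or.inr ⟨h1.symm, h2⟩

theorem TOpen.replace {a a' b c : V} (h : TOpen M Z a b c) (ha : M.Arr a b) (ha' : M.Arr a' b) :
    TOpen M Z a' b c := by
  rcases h with ⟨h1, h2, h3⟩ | ⟨h1 | h1, h2⟩
  · exact Or.inl ⟨ha', h2, h3⟩
  · exact absurd h1 ha.not_tl
  · exact Or.inr ⟨Or.inr h1, h2⟩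

/-- If the junction `a, b, c` is open but `a, b, d` is not, and there is no edge `b → c`
with an arrowhead at `b` from `d`, then `b` is a collider in `Z` and `b → d`. -/
theorem junction (hG : IsMixed M) {a b c d : V} (h : TOpen M Z a b c) (hn : ¬ TOpen M Z a b d)
    (hab : M.Adj a b) (hbd : M.Adj b d) (hx : M.DirEdge b c → M.Arr d b → M.Arr a b → AnZ M Z b) :
    M.Arr a b ∧ M.Arr c b ∧ M.DirEdge b d ∧ b ∈ Z := by
  rcases hG.arr_or hbd.symm' with hd | hd
  · exfalso
    rcases h with ⟨h1, h2, h3⟩ | ⟨h1 | h1, h2⟩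
    · exact hn (Or.inl ⟨h1, hd, h3⟩)
    · exact hn (Or.inr ⟨Or.inl h1, h2⟩)
    · by_cases ha : M.Arr a b
      · exact hn (Or.inl ⟨ha, hd, hx (hG.dir_of_tl h1) hd ha⟩)
      · exact hn (Or.inr ⟨Or.inl (hG.dir_of_not_arr hab ha).2, h2⟩)
  · have hbZ : b ∈ Z := by
      by_contra hb
      exact hn (Or.inr ⟨Or.inr hd.2, hb⟩)
    rcases h with ⟨h1, h2, h3⟩ | ⟨h1, h2⟩
    · exact ⟨h1, h2, hd, hbZ⟩
    · exact absurd hbZ h2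

/-- The node at position `l+1` is a collider in `M`. -/
def Coll (M : PMG V) (v : ℕ → V) (l : ℕ) : Prop :=
  M.Arr (v l) (v (l+1)) ∧ M.Arr (v (l+2)) (v (l+1))

/-- The result of the analysis on the left of position `i+1`. -/
def LRes (P M : PMG V) (Z : Finset V) (v : ℕ → V) (n i j : ℕ) : Prop :=
  j < i ∧ (∀ l, j ≤ l → l < i → Coll M v l ∧ M.DirEdge (v (l+1)) (v (i+2)) ∧ v (l+1) ∈ Z) ∧
    (¬ M.Adj (v j) (v (i+2)) ∨ (j = 0 ∧ M.DirEdge (v 0) (v (i+2)) ∧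
      (∀ k, i + 2 ≤ k → k < n → ¬ M.Arr (v (k+1)) (v k)) ∧ Visible P (v 0) (v (i+2))))

/-- The result of the analysis on the right of position `i+1`. -/
def RRes (M : PMG V) (v : ℕ → V) (n i k : ℕ) : Prop :=
  i < k ∧ k + 2 ≤ n ∧ (∀ l, i < l → l ≤ k → Coll M v l ∧ M.DirEdge (v (l+1)) (v i)) ∧
    ¬ M.Adj (v (k+2)) (v i)

theorem left_chain (hP : IsPAGOf P cls) (hM : M ∈ cls) (hs : Setup P M Z v n) {i : ℕ}
    (hi : i + 2 ≤ n) : ∀ k, k < i →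
    (∀ l, k ≤ l → l < i → Coll M v l ∧ M.DirEdge (v (l+1)) (v (i+2)) ∧ v (l+1) ∈ Z) →
    ∃ j, LRes P M Z v n i j := by
  have hG := hP.mixed hM
  have hA := hP.anc hM
  intro k
  induction k with
  | zero =>
    intro hk h
    by_cases hadj : M.Adj (v 0) (v (i+2))
    · obtain ⟨e, rfl⟩ : ∃ e, i = e + 1 := ⟨i - 1, by omega⟩
      have h0 := h 0 le_rfl hk
      have he := h e (by omega) (by omega)
      have hv := hA.arr_trans h0.1.1 h0.2.1 hadj
      have hi1 := hA.arr_trans he.1.2 he.2.1 (hs.adj (e+2) (by omega))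
      obtain ⟨-, q2, q3⟩ := hs.skip 0 (e+1+2) (by omega) hi hadj (by intro k hk; omega)
        (fun hlt => (hs.opn (e+2) (by omega)).replace hi1 hv)
      have q4 := hs.forb 0 (e+1+2) (by omega) hi ((hP.adj hM).2 hadj) (by intro k hk; omega)
        (fun h => q2 (hP.arr h hM)) (fun k h1 h2 h3 => q3 k h1 h2 (hP.arr h3 hM))
      exact ⟨0, hk, h, Or.inr ⟨rfl, hG.dir_of_not_arr hadj.symm' q2, q3, q4.2 rfl⟩⟩
    · exact ⟨0, hk, h, Or.inl hadj⟩
  | succ k ih =>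
    intro hk h
    by_cases hadj : M.Adj (v (k+1)) (v (i+2))
    · obtain ⟨e, rfl⟩ : ∃ e, i = e + 1 := ⟨i - 1, by omega⟩
      have h0 := h (k+1) le_rfl hk
      have he := h e (by omega) (by omega)
      have hv := hA.arr_trans h0.1.1 h0.2.1 hadj
      have hi1 := hA.arr_trans he.1.2 he.2.1 (hs.adj (e+2) (by omega))
      by_cases ho : TOpen M Z (v k) (v (k+1)) (v (e+1+2))
      · exfalso
        obtain ⟨q1, q2, q3⟩ := hs.skip (k+1) (e+1+2) (by omega) hi hadj
          (by intro k' hk'; obtain rfl : k' = k := by omega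
              exact ho)
          (fun hlt => (hs.opn (e+2) (by omega)).replace hi1 hv)
        have q4 := hs.forb (k+1) (e+1+2) (by omega) hi ((hP.adj hM).2 hadj)
          (fun k h1 h3 => q1 k h1 (hP.arr h3 hM))
          (fun h => q2 (hP.arr h hM)) (fun k h1 h2 h3 => q3 k h1 h2 (hP.arr h3 hM))
        have q5 := q4.1 (k+1) (by omega) (Or.inl le_rfl)
        rcases hs.opn k (by omega) with ⟨-, -, t⟩ | ⟨t | t, -⟩
        · exact q5 t
        · exact q1 k (by omega) (hG.dir_of_tl t).1
        · exact q5 (AnZ.cons (hG.dir_of_tl t) (AnZ.of_mem h0.2.2))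
      · obtain ⟨j1, j2, j3, j4⟩ := junction hG (hs.opn k (by omega)) ho (hs.adj k (by omega)) hadj
          (fun t1 t2 _ => absurd t2 (hA.dir_trans t1 h0.2.1 hadj).not_arr)
        refine ih (by omega) ?_
        intro l hl1 hl2
        rcases Nat.eq_or_lt_of_le hl1 with rfl | hl
        · exact ⟨⟨j1, j2⟩, j3, j4⟩
        · exact h l hl hl2
    · exact ⟨k+1, hk, h, Or.inl hadj⟩

theorem right_chain (hP : IsPAGOf P cls) (hM : M ∈ cls) (hs : Setup P M Z v n) {i : ℕ} :
    ∀ d k, k + 2 + d = n → i < k →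
    (∀ l, i < l → l ≤ k → Coll M v l ∧ M.DirEdge (v (l+1)) (v i)) →
    ∃ k, RRes M v n i k := by
  have hG := hP.mixed hM
  have hA := hP.anc hM
  intro d
  induction d with
  | zero =>
    intro k hkn hk h
    refine ⟨k, hk, by omega, h, fun hadj => ?_⟩
    have h0 := h k hk le_rfl
    have he := h (i+1) (by omega) (by omega)
    have hv := hA.arr_trans h0.1.2 h0.2 hadj
    have hi1 := hA.arr_trans he.1.1 he.2 (hs.adj i (by omega)).symm'
    refine (hs.skip i (k+2) (by omega) (by omega) hadj.symm' ?_ ?_).2.1 hv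
    · rintro e rfl
      exact ((hs.opn e (by omega)).symm'.replace hi1 hv).symm'
    · intro; omega
  | succ d ih =>
    intro k hkn hk h
    by_cases hadj : M.Adj (v (k+2)) (v i)
    · have h0 := h k hk le_rfl
      have he := h (i+1) (by omega) (by omega)
      have hv := hA.arr_trans h0.1.2 h0.2 hadj
      have hi1 := hA.arr_trans he.1.1 he.2 (hs.adj i (by omega)).symm'
      by_cases ho : TOpen M Z (v i) (v (k+2)) (v (k+3))
      · exfalso
        refine (hs.skip i (k+2) (by omega) (by omega) hadj.symm' ?_ (fun _ => ho)).2.1 hv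
        rintro e rfl
        exact ((hs.opn e (by omega)).symm'.replace hi1 hv).symm'
      · obtain ⟨j1, j2, j3, j4⟩ := junction hG (hs.opn (k+1) (by omega)).symm'
          (fun t => ho t.symm') (hs.adj (k+2) (by omega)).symm' hadj
          (fun t1 t2 _ => absurd t2 (hA.dir_trans t1 h0.2 hadj).not_arr)
        refine ih (k+1) (by omega) (by omega) ?_
        intro l hl1 hl2
        rcases Nat.eq_or_lt_of_le hl2 with rfl | hl
        · exact ⟨⟨j2, j1⟩, j3⟩
        · exact h l hl1 (by omega)
    · exact ⟨k, hk, by omega, h, hadj⟩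

/-- The triple centered at position `i+1` is not of definite status in `P`. -/
def Bad (P : PMG V) (v : ℕ → V) (n i : ℕ) : Prop :=
  i + 2 ≤ n ∧ ¬ TDef P (v i) (v (i+1)) (v (i+2))

theorem bad_cases (hP : IsPAGOf P cls) (hM : M ∈ cls) (hs : Setup P M Z v n) {i : ℕ}
    (hb : Bad P v n i) : (∃ j, LRes P M Z v n i j) ∨ (∃ k, RRes M v n i k) := by
  have hG := hP.mixed hM
  have hA := hP.anc hM
  obtain ⟨hi, hb⟩ := hb
  have hPa : P.Adj (v i) (v (i+2)) := by
    by_contra hna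
    exact hb (unshielded hP (fun h => by have := hs.inj _ _ (by omega) hi h; omega) hna
      ((hP.adj hM).2 (hs.adj i (by omega))) ((hP.adj hM).2 (hs.adj (i+1) (by omega)).symm'))
  have hadj := (hP.adj hM).1 hPa
  have hm := hs.opn i hi
  by_cases hL : ∀ k, k + 1 = i → TOpen M Z (v k) (v i) (v (i+2))
  swap
  · left
    push Not at hL
    obtain ⟨e, rfl, ho⟩ := hL
    obtain ⟨j1, j2, j3, j4⟩ := junction hG (hs.opn e (by omega)) ho (hs.adj e (by omega)) hadj
      (by
        intro t1 t2 _
        rcases hm with ⟨-, -, t⟩ | ⟨t | t, -⟩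
        · exact AnZ.cons t1 t
        · exact absurd t (Arr.not_tl t1.1)
        · exact absurd (hA.dir_trans t1 (hG.dir_of_tl t) hadj) fun t' => t'.not_arr t2)
    refine left_chain hP hM hs hi e (by omega) ?_
    intro l hl1 hl2
    obtain rfl : l = e := by omega
    exact ⟨⟨j1, j2⟩, j3, j4⟩
  by_cases hR : i + 2 < n → TOpen M Z (v i) (v (i+2)) (v (i+2+1))
  swap
  · right
    push Not at hR
    obtain ⟨hlt, ho⟩ := hR
    obtain ⟨j1, j2, j3, j4⟩ := junction hG (hs.opn (i+1) (by omega)).symm'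
      (fun t => ho t.symm') (hs.adj (i+2) (by omega)).symm' hadj.symm'
      (by
        intro t1 t2 _
        rcases hm with ⟨-, -, t⟩ | ⟨t | t, -⟩
        · exact AnZ.cons t1 t
        · exact absurd (hA.dir_trans t1 (hG.dir_of_tl t) hadj.symm') fun t' => t'.not_arr t2
        · exact absurd t (Arr.not_tl t1.1))
    obtain ⟨d, hd⟩ : ∃ d, i + 1 + 2 + d = n := ⟨n - (i+3), by omega⟩
    refine right_chain hP hM hs d (i+1) hd (by omega) ?_
    intro l hl1 hl2
    obtain rfl : l = i + 1 := by omega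
    exact ⟨⟨j2, j1⟩, j3⟩
  exfalso
  obtain ⟨q1, q2, q3⟩ := hs.skip i (i+2) (by omega) hi hadj hL hR
  have q4 := hs.forb i (i+2) (by omega) hi hPa
          (fun k h1 h3 => q1 k h1 (hP.arr h3 hM))
          (fun h => q2 (hP.arr h hM)) (fun k h1 h2 h3 => q3 k h1 h2 (hP.arr h3 hM))
  rcases i with _ | i
  · have hvis := q4.2 rfl
    by_cases h10 : M.Arr (v 1) (v 0)
    · exact hb (vis_disc hP hvis ((hP.adj hM).2 (hs.adj 0 (by omega)).symm')
        ((hP.adj hM).2 (hs.adj 1 (by omega))) hM h10)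
    · have d01 := hG.dir_of_not_arr (hs.adj 0 (by omega)).symm' h10
      obtain ⟨k, hk, hka⟩ := hs.nc
      have hk1 : k = 1 := by
        by_contra hne
        by_cases h0 : k = 0
        · subst h0; exact h10 hka
        · exact q3 k (by omega) hk hka
      subst hk1
      have hz : AnZ M Z (v 1) := by
        rcases hm with ⟨-, -, t⟩ | ⟨t | t, -⟩
        · exact t
        · exact absurd t (Arr.not_tl d01.1)
        · exact absurd t (Arr.not_tl hka)
      have hP21 : P.Arr (v 2) (v 1) := by
        by_contra hn
        refine (hs.forb 0 1 (by omega) (by omega) ((hP.adj hM).2 (hs.adj 0 (by omega)))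
          (by intro k hk; omega) (fun h => h10 (hP.arr h hM)) ?_).1 1 le_rfl
          (Or.inr ⟨le_rfl, by omega⟩) hz
        intro k h1 h2 h3
        by_cases hk : k = 1
        · subst hk; exact hn h3
        · exact q3 k (by omega) h2 (hP.arr h3 hM)
      have hP01 : P.Arr (v 0) (v 1) := by
        have ha := (hP.adj hM).2 (hs.adj 0 (by omega))
        refine hP.arr_of ha fun M' hM' => ?_
        exact (hP.anc hM').arr_trans' (hP.dir hvis.1 hM') (hP.arr hP21 hM') ((hP.adj hM').1 ha)
      exact hb (Or.inl ⟨hP01, hP21⟩)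
  · have q5 := q4.1 (i+1) (by omega) (Or.inl le_rfl)
    have d1 : M.DirEdge (v (i+1)) (v (i+2)) := by
      rcases hs.opn i (by omega) with ⟨-, -, t⟩ | ⟨t | t, -⟩
      · exact absurd t q5
      · exact absurd (hG.dir_of_tl t).1 (q1 i (by omega))
      · exact hG.dir_of_tl t
    have d2 : M.DirEdge (v (i+2)) (v (i+3)) := by
      rcases hm with ⟨-, -, t⟩ | ⟨t | t, -⟩
      · exact absurd (AnZ.cons d1 t) q5
      · exact absurd t (Arr.not_tl d1.1)
      · exact hG.dir_of_tl t
    obtain ⟨k, hk, hka⟩ := hs.nc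
    by_cases h1 : k < i + 1
    · exact q1 k h1 hka
    by_cases h2 : k = i + 1
    · subst h2; exact d1.not_arr hka
    by_cases h3 : k = i + 2
    · subst h3; exact d2.not_arr hka
    · exact q3 k (by omega) hk hka

theorem left_dep (hP : IsPAGOf P cls) (hM : M ∈ cls) (hs : Setup P M Z v n) {i j : ℕ}
    (hb : Bad P v n i) (h : LRes P M Z v n i j) : ∃ l, j ≤ l ∧ l < i ∧ Bad P v n l := by
  obtain ⟨hi, hb⟩ := hb
  obtain ⟨hj, hc, hend⟩ := h
  by_contra hno
  push Not at hno
  have hcol : ∀ l, j ≤ l → l < i → P.Arr (v l) (v (l+1)) ∧ P.Arr (v (l+2)) (v (l+1)) := by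
    intro l h1 h2
    have ht : TDef P (v l) (v (l+1)) (v (l+2)) := by
      by_contra ht
      exact hno l h1 h2 ⟨by omega, ht⟩
    have := (hc l h1 h2).1
    exact coll_of_tdef hP hM (fun h => by have := hs.inj _ _ (by omega) (by omega) h; omega)
      ht this.1 this.2
  have hlast : P.Arr (v (i+1)) (v i) := by
    have := (hcol (i-1) (by omega) (by omega)).2
    rwa [show i - 1 + 2 = i + 1 by omega, show i - 1 + 1 = i by omega] at this
  have hby : P.Adj (v (i+1)) (v (i+2)) := (hP.adj hM).2 (hs.adj (i+1) (by omega))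
  have hback : ∀ l, j < l → l < i → P.Arr (v (l+1)) (v l) := by
    intro l h1 h2
    have := (hcol (l-1) (by omega) (by omega)).2
    rwa [show l - 1 + 2 = l + 1 by omega, show l - 1 + 1 = l by omega] at this
  have hpar : ∀ l, j < l → l ≤ i → M.DirEdge (v l) (v (i+2)) := by
    intro l h1 h2
    have := (hc (l-1) (by omega) (by omega)).2.1
    rwa [show l - 1 + 1 = l by omega] at this
  rcases hend with hend | ⟨rfl, h0, hdir, hvis⟩
  · apply hb
    have := disc_path hP hM (y := v (i+2)) (b := v (i+1)) (fun k => v (j+k)) (i-j) (by omega)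
      (fun h => by have := hs.inj _ _ (by omega) (by omega) h; omega)
      (fun h => hend ((hP.adj hM).1 h).symm') (hcol j le_rfl hj).1
      (fun l h1 h2 => ⟨(hcol (j+l) (by omega) (by omega)).1, hback (j+l) (by omega) (by omega)⟩)
      (fun l h1 h2 => hpar (j+l) (by omega) (by omega))
      (by simpa [show j + (i - j) = i by omega] using hlast) hby
    simpa [show j + (i - j) = i by omega] using this
  · apply hb
    have h10 : P.Arr (v 1) (v 0) := by
      by_contra hn
      refine (hs.forb 1 (i+2) (by omega) hi ((hP.adj hM).2 (hpar 1 (by omega) (by omega)).adj)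
        ?_ (fun h => (hpar 1 (by omega) (by omega)).not_arr (hP.arr h hM))
        (fun k h1 h2 h3 => hdir k h1 h2 (hP.arr h3 hM))).1 1 le_rfl (Or.inl le_rfl)
        (AnZ.of_mem (hc 0 le_rfl hj).2.2)
      intro k hk
      obtain rfl : k = 0 := by omega
      exact hn
    refine disc_path_vis hP hM (y := v (i+2)) (b := v (i+1)) v i (by omega) hvis ?_
      (fun l h1 h2 => hpar l (by omega) (by omega)) hlast hby
    intro l hl
    refine ⟨(hcol l (by omega) hl).1, ?_⟩
    rcases l with _ | l
    · exact h10
    · exact hback _ (by omega) hl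

theorem right_dep (hP : IsPAGOf P cls) (hM : M ∈ cls) (hs : Setup P M Z v n) {i k : ℕ}
    (hb : Bad P v n i) (h : RRes M v n i k) : ∃ l, i < l ∧ l ≤ k ∧ Bad P v n l := by
  obtain ⟨hi, hb⟩ := hb
  obtain ⟨hk, hkn, hc, hend⟩ := h
  by_contra hno
  push Not at hno
  have hcol : ∀ l, i < l → l ≤ k → P.Arr (v l) (v (l+1)) ∧ P.Arr (v (l+2)) (v (l+1)) := by
    intro l h1 h2
    have ht : TDef P (v l) (v (l+1)) (v (l+2)) := by
      by_contra ht
      exact hno l h1 h2 ⟨by omega, ht⟩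
    have := (hc l h1 h2).1
    exact coll_of_tdef hP hM (fun h => by have := hs.inj _ _ (by omega) (by omega) h; omega)
      ht this.1 this.2
  apply hb
  apply TDef.symm'
  have hin : ∀ l, 1 ≤ l → l ≤ k - i → ∃ s, i < s ∧ s ≤ k ∧ k + 2 - l = s + 1 ∧
      k + 2 - (l + 1) = s ∧ k + 2 - (l - 1) = s + 2 := fun l h1 h2 =>
    ⟨k + 1 - l, by omega, by omega, by omega, by omega, by omega⟩
  have e0 : k + 2 - (k - i) = i + 2 := by omega
  have := disc_path hP hM (y := v i) (b := v (i+1)) (fun l => v (k+2-l)) (k-i) (by omega)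
      (fun h => by have := hs.inj _ _ (by omega) (by omega) h; omega)
      (fun h => hend ((hP.adj hM).1 h).symm')
      (by simpa using (hcol k hk le_rfl).2)
      (fun l h1 h2 => by
        obtain ⟨s, s1, s2, s3, s4, s5⟩ := hin l h1 (by omega)
        obtain ⟨t, t1, t2, t3, t4, t5⟩ := hin (l+1) (by omega) (by omega)
        obtain rfl : s = t + 1 := by omega
        simp only [s3, s4]
        exact ⟨(hcol t t1 t2).2, (hcol _ s1 s2).1⟩)
      (fun l h1 h2 => by
        obtain ⟨s, s1, s2, s3, s4, s5⟩ := hin l h1 (by omega)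
        simp only [s3]
        exact (hc s s1 s2).2)
      (by simpa only [e0] using (hcol (i+1) (by omega) (by omega)).1)
      ((hP.adj hM).2 (hs.adj i (by omega)).symm')
  simpa only [e0] using this

theorem no_bad (hP : IsPAGOf P cls) (hM : M ∈ cls) (hs : Setup P M Z v n) (i : ℕ) :
    ¬ Bad P v n i := by
  have hG := hP.mixed hM
  have hA := hP.anc hM
  intro hbad
  -- the greatest bad index has a left result
  have hex : ∃ b, Bad P v n b ∧ ∃ j, LRes P M Z v n b j := by
    have hub : ∀ d i, i + d = n → Bad P v n i → ∃ b, Bad P v n b ∧ ∃ j, LRes P M Z v n b j := by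
      intro d
      induction d using Nat.strong_induction_on with
      | _ d ih =>
        intro i hid hb
        rcases bad_cases hP hM hs hb with h | ⟨k, h⟩
        · exact ⟨i, hb, h⟩
        · obtain ⟨l, h1, h2, h3⟩ := right_dep hP hM hs hb h
          exact ih (n - l) (by have := h3.1; omega) l (by have := h3.1; omega) h3
    exact hub (n - i) i (by have := hbad.1; omega) hbad
  obtain ⟨hb, j, hL⟩ := Nat.find_spec hex
  have hmin := fun a (ha : a < Nat.find hex) => Nat.find_min hex ha
  generalize Nat.find hex = b at hb hL hmin
  -- the greatest bad index below `b`
  have hgr : ∃ a, j ≤ a ∧ a < b ∧ Bad P v n a ∧ ∀ l, a < l → l < b → ¬ Bad P v n l := by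
    have hub : ∀ d a, a + d = b → j ≤ a → a < b → Bad P v n a →
        ∃ a, j ≤ a ∧ a < b ∧ Bad P v n a ∧ ∀ l, a < l → l < b → ¬ Bad P v n l := by
      intro d
      induction d using Nat.strong_induction_on with
      | _ d ih =>
        intro a had hja hab hba
        by_cases h : ∀ l, a < l → l < b → ¬ Bad P v n l
        · exact ⟨a, hja, hab, hba, h⟩
        · push Not at h
          obtain ⟨l, h1, h2, h3⟩ := h
          exact ih (b - l) (by omega) l (by omega) (by omega) h2 h3
    obtain ⟨l, h1, h2, h3⟩ := left_dep hP hM hs hb hL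
    exact hub (b - l) l (by omega) h1 h2 h3
  obtain ⟨a, hja, hab, hba, hgap⟩ := hgr
  obtain ⟨k, hR⟩ : ∃ k, RRes M v n a k := by
    rcases bad_cases hP hM hs hba with h | h
    · exact absurd ⟨hba, h⟩ (hmin a hab)
    · exact h
  obtain ⟨l, l1, l2, l3⟩ := right_dep hP hM hs hba hR
  have hbl : b ≤ l := by
    by_contra h
    exact hgap l l1 (by omega) l3
  obtain ⟨-, hkn, hRc, -⟩ := hR
  obtain ⟨-, hLc, hend⟩ := hL
  have hCb := hRc b hab (by omega)
  have hbn := hb.1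
  have fin : ¬ M.DirEdge (v a) (v (b+2)) := fun h =>
    (hA.dir_trans hCb.2 h (hs.adj (b+1) (by omega))).not_arr hCb.1.2
  by_cases haj : a = j
  · subst haj
    rcases hend with hend | ⟨rfl, h0, -⟩
    · have hne : v (b+2) ≠ v a := fun h => by
        have := hs.inj _ _ (by omega) (by omega) h
        omega
      obtain ⟨S, hS⟩ := hP.sep hne (fun h => hend ((hP.adj hM).1 h).symm')
      have hcw : ∀ d, a + d ≤ b → CW M S (v a) (v (a+d+1)) := by
        intro d
        induction d with
        | zero => intro _; exact CW.base (hLc a le_rfl hab).1.1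
        | succ d ih =>
          intro hd
          have hc := ih (by omega)
          have hl := hLc (a+d) (by omega) (by omega)
          have hf : M.Arr (v (a+d+1)) (v (a+d+2)) := by
            rcases Nat.eq_or_lt_of_le hd with h | h
            · rw [show a + d + 2 = b + 1 by omega, show a + d + 1 = b by omega]
              exact hCb.1.1
            · exact (hLc (a+d+1) (by omega) (by omega)).1.1
          exact CW.step hc ((hS.key hP hM hc hl.2.1.adj).2 hl.2.1) hf hl.1.2
      have hcb := hcw (b - a) (by omega)
      rw [show a + (b - a) + 1 = b + 1 by omega] at hcb
      have hnot : v (b+1) ∉ S := fun h =>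
        ((hS.key hP hM hcb (hs.adj (b+1) (by omega))).1 h).not_arr hCb.1.2
      exact hnot (noncoll_mem (hS.2.2 M hM).2 hne (hs.adj (b+1) (by omega)).symm'
        hCb.2.adj (Or.inr hCb.2.2))
    · exact fin h0
  · have := (hLc (a-1) (by omega) (by omega)).2.1
    rw [show a - 1 + 1 = a by omega] at this
    exact fin this

theorem not_possDir (hP : IsPAGOf P cls) (hM : M ∈ cls) (hs : Setup P M Z v n)
    (h : ∀ k, k < n → ¬ P.Arr (v (k+1)) (v k)) : False := by
  have hG := hP.mixed hM
  have hn : 0 < n := by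
    obtain ⟨k, hk, -⟩ := hs.nc
    omega
  obtain ⟨q1, q2⟩ := hs.forb 0 1 (by omega) (by omega) ((hP.adj hM).2 (hs.adj 0 hn))
    (by intro k hk; omega) (h 0 hn) (fun k _ h2 => h k h2)
  have hvis := hP.dir (q2 rfl).1 hM
  obtain ⟨hk, hka⟩ := Nat.find_spec hs.nc
  have hmin := fun a (ha : a < Nat.find hs.nc) => Nat.find_min hs.nc ha
  generalize Nat.find hs.nc = k at hk hka hmin
  rcases k with _ | k
  · exact hvis.not_arr hka
  · have hd : M.DirEdge (v k) (v (k+1)) :=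
      hG.dir_of_not_arr (hs.adj k (by omega)).symm' fun t => hmin k (by omega) ⟨by omega, t⟩
    rcases hs.opn k (by omega) with ⟨-, -, t⟩ | ⟨t | t, -⟩
    · exact q1 (k+1) (by omega) (Or.inr ⟨by omega, by omega⟩) t
    · exact absurd t (Arr.not_tl hd.1)
    · exact absurd t (Arr.not_tl hka)

end PMG

open PMG in
/-- Lemma 5.6: a shortest proper non-causal m-connecting path in a MAG corresponds
to a proper definite status non-causal path in its PAG. -/
theorem shortest_noncausal_mconn_is_defstatus_in_pag {V : Type} [Fintype V] [DecidableEq V]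
    (P : PMG V) (cls : Set (PMG V)) (hP : IsPAGOf P cls)
    (M : PMG V) (hM : M ∈ cls) (X Y Z : Finset V)
    (hXY : Disjoint X Y) (hXZ : Disjoint X Z) (hYZ : Disjoint Y Z)
    (hX : X.Nonempty) (hY : Y.Nonempty)
    (hAm : Amenable P (Visible P) X Y)
    (hZforb : ∀ z ∈ Z, z ∉ Forb P X Y)
    (p : List V)
    (hprop : ProperPath M X Y p) (hnc : ¬ PossDirAlong M p) (hmc : MConn M Z p)
    (hshort : ∀ q, ProperPath M X Y q → ¬ PossDirAlong M q → MConn M Z q →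
      p.length ≤ q.length) :
    ProperPath P X Y p ∧ DefStatus P p ∧ ¬ PossDirAlong P p := by
  obtain ⟨v, n, hlen, hv, hs⟩ := exists_setup hP hM hAm hZforb p hprop hnc hmc hshort
  refine ⟨proper_iff hP hM hprop, ?_, ?_⟩
  · intro i hi
    have ht : TDef P (v i) (v (i+1)) (v (i+2)) := by
      by_contra ht
      exact no_bad hP hM hs i ⟨by omega, ht⟩
    have e0 := hv i (by omega)
    have e1 := hv (i+1) (by omega)
    have e2 := hv (i+2) (by omega)
    rcases ht with ht | ht
    · exact Or.inl ⟨_, _, _, e0, e1, e2, ht.1, ht.2⟩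
    · exact Or.inr ⟨_, _, _, e0, e1, e2, ht⟩
  · intro hpd
    exact not_possDir hP hM hs fun k hk =>
      hpd k _ _ (hv k (by omega)) (hv (k+1) (by omega))
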